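/- Let k be a number field and let a₁, b₁, a₂, b₂ ∈ k be nonzero. Then there exists a field extension k' of k with [k' : k] = 2 such that both equations x² − a₁·y² − b₁·z² = 0 and x² − a₂·y² − b₂·z² = 0 have solutions (x, y, z) ∈ k'³ with (x, y, z) ≠ (0, 0, 0). -/

import Mathlib

namespace CQ
open IsDedekindDomain NumberField WithZero

universe u

set_option linter.unusedSectionVars false
set_option linter.unusedSimpArgs false
set_option linter.unusedVariables false

variable {K : Type u} [Field K] [NumberField K]

/-- finite places -/
abbrev Pl (K : Type u) [Field K] [NumberField K] := HeightOneSpectrum (𝓞 K)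

lemma v4_ne (v : Pl K) : v.valuation K 4 ≠ 0 := by
  rw [Ne, Valuation.zero_iff]; norm_num

lemma v2_le (v : Pl K) : v.valuation K 2 ≤ 1 := by
  have h : v.valuation K (algebraMap (𝓞 K) K 2) ≤ 1 := v.valuation_le_one 2
  rwa [map_ofNat] at h

lemma v4_eq (v : Pl K) : v.valuation K 4 = v.valuation K 2 ^ 2 := by
  rw [← map_pow]; norm_num

lemma v4_le (v : Pl K) : v.valuation K 4 ≤ 1 := by
  rw [v4_eq]; exact pow_le_one₀ zero_le (v2_le v)

lemma val_one_of_lt {v : Pl K} {x : K} (h : v.valuation K (x - 1) < 1) : v.valuation K x = 1 := by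
  have := Valuation.map_add_eq_of_lt_right (v := v.valuation K) (x := x - 1) (y := 1) (by simpa using h)
  simpa using this

/-- congruence units of level `4 P` -/
def W (v : Pl K) : Subgroup Kˣ where
  carrier := {x | v.valuation K ((x : K) - 1) < v.valuation K 4}
  one_mem' := by simpa using (zero_lt_iff.2 (v4_ne v))
  mul_mem' := by
    intro x y hx hy
    simp only [Set.mem_ofPred_eq] at *
    have h1 : v.valuation K (x : K) = 1 := val_one_of_lt (hx.trans_le (v4_le v))
    have : ((x * y : Kˣ) : K) - 1 = x * (y - 1) + (x - 1) := by push_cast; ring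
    rw [this]
    refine Valuation.map_add_lt _ ?_ hx
    rwa [map_mul, h1, one_mul]
  inv_mem' := by
    intro x hx
    simp only [Set.mem_ofPred_eq] at *
    have h1 : v.valuation K (x : K) = 1 := val_one_of_lt (hx.trans_le (v4_le v))
    have : ((x⁻¹ : Kˣ) : K) - 1 = - ((x : K)⁻¹ * (x - 1)) := by
      push_cast; field_simp; ring
    rw [this, Valuation.map_neg, map_mul, map_inv₀, h1, inv_one, one_mul]
    exact hx

lemma mem_W {v : Pl K} {x : Kˣ} : x ∈ W v ↔ v.valuation K ((x : K) - 1) < v.valuation K 4 := Iff.rfl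

lemma W_val {v : Pl K} {x : Kˣ} (hx : x ∈ W v) : v.valuation K (x : K) = 1 :=
  val_one_of_lt (lt_of_lt_of_le hx (v4_le v))

/-- global squares -/
def GSq (K : Type u) [Field K] : Subgroup Kˣ := (powMonoidHom 2 : Kˣ →* Kˣ).range

lemma mem_GSq {x : Kˣ} : x ∈ GSq K ↔ ∃ z : Kˣ, z ^ 2 = x := Iff.rfl

/-- local squares -/
def Sq (v : Pl K) : Subgroup Kˣ := GSq K ⊔ W v

lemma mem_Sq {v : Pl K} {x : Kˣ} : x ∈ Sq v ↔ ∃ z : Kˣ, ∃ w ∈ W v, z ^ 2 * w = x := by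
  rw [Sq, Subgroup.mem_sup]
  constructor
  · rintro ⟨_, ⟨z, rfl⟩, w, hw, h⟩; exact ⟨z, w, hw, h⟩
  · rintro ⟨z, w, hw, h⟩; exact ⟨_, ⟨z, rfl⟩, w, hw, h⟩

lemma sq_mem_Sq (v : Pl K) (z : Kˣ) : z ^ 2 ∈ Sq v := Subgroup.mem_sup_left ⟨z, rfl⟩

lemma W_le_Sq (v : Pl K) : W v ≤ Sq v := le_sup_right

/-- global norms from `K(√a)` -/
def Nm (a : K) : Subgroup Kˣ where
  carrier := {c | ∃ x y : K, (c : K) = x ^ 2 - a * y ^ 2}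
  one_mem' := ⟨1, 0, by simp⟩
  mul_mem' := by
    rintro c d ⟨x, y, h⟩ ⟨z, t, h'⟩
    exact ⟨x * z + a * y * t, x * t + y * z, by push_cast; rw [h, h']; ring⟩
  inv_mem' := by
    rintro c ⟨x, y, h⟩
    refine ⟨x / c, y / c, ?_⟩
    have : (c : K) ≠ 0 := c.ne_zero
    push_cast
    field_simp
    rw [h]

lemma mem_Nm {a : K} {c : Kˣ} : c ∈ Nm a ↔ ∃ x y : K, (c : K) = x ^ 2 - a * y ^ 2 := Iff.rfl

lemma GSq_le_Nm (a : K) : GSq K ≤ Nm a := by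
  rintro _ ⟨z, rfl⟩
  exact ⟨z, 0, by simp⟩

/-- local norms from `K(√a)` -/
def Ng (v : Pl K) (a : K) : Subgroup Kˣ := Nm a ⊔ W v

lemma Sq_le_Ng (v : Pl K) (a : K) : Sq v ≤ Ng v a := sup_le_sup_right (GSq_le_Nm a) _

lemma Nm_le_Ng (v : Pl K) (a : K) : Nm a ≤ Ng v a := le_sup_left

lemma mem_Ng {v : Pl K} {a : K} {c : Kˣ} :
    c ∈ Ng v a ↔ ∃ n ∈ Nm a, ∃ w ∈ W v, n * w = c := by
  rw [Ng, Subgroup.mem_sup]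

lemma div_mem_W {v : Pl K} {x y : Kˣ}
    (h : v.valuation K ((x : K) - y) < v.valuation K 4 * v.valuation K (y : K)) : x / y ∈ W v := by
  rw [mem_W]
  have hy : v.valuation K (y : K) ≠ 0 := by simp
  have : ((x / y : Kˣ) : K) - 1 = ((x : K) - y) / y := by
    push_cast; field_simp
  rw [this, map_div₀]
  exact (div_lt_iff₀ (zero_lt_iff.2 hy)).2 h

lemma mem_Sq_of_lt {v : Pl K} {c : Kˣ} {z : K}
    (h : v.valuation K (z ^ 2 - c) < v.valuation K 4 * v.valuation K (c : K)) : c ∈ Sq v := by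
  have hz : z ≠ 0 := by
    rintro rfl
    have h1 : v.valuation K (c : K) < v.valuation K 4 * v.valuation K (c : K) := by
      simpa [Valuation.map_neg] using h
    exact absurd h1 (not_lt.2 (mul_le_of_le_one_left' (v4_le v)))
  have hw : (Units.mk0 z hz) ^ 2 / c ∈ W v := div_mem_W (by simpa using h)
  refine mem_Sq.2 ⟨Units.mk0 z hz, _, inv_mem hw, ?_⟩
  simp

/-- if `a` is not a local square, the norm form is not too small -/
lemma norm_ge {v : Pl K} {a : Kˣ} (ha : a ∉ Sq v) (x y : K) :
    v.valuation K 4 * v.valuation K ((a : K) * y ^ 2) ≤ v.valuation K (x ^ 2 - a * y ^ 2) := by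
  by_contra! h
  have hy : y ≠ 0 := by
    rintro rfl
    simp at h
  apply ha
  apply mem_Sq_of_lt (z := x / y)
  have : (x / y) ^ 2 - (a : K) = (x ^ 2 - a * y ^ 2) / y ^ 2 := by field_simp
  rw [this, map_div₀, div_lt_iff₀ (by simpa [zero_lt_iff] using hy)]
  rwa [mul_assoc, ← map_mul]

lemma Ng_stable {v : Pl K} {a a' : Kˣ} (ha : a ∉ Sq v)
    (h : v.valuation K ((a' : K) / a - 1) < v.valuation K 16) :
    Ng v (a : K) ≤ Ng v (a' : K) := by
  refine sup_le ?_ le_sup_right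
  rintro c ⟨x, y, hc⟩
  have hge := norm_ge ha x y
  have h16 : v.valuation K 16 = v.valuation K 4 * v.valuation K 4 := by
    rw [← map_mul]; norm_num
  have e1 : x ^ 2 - (a' : K) * y ^ 2 - c = - (a * y ^ 2 * ((a' : K) / a - 1)) := by
    rw [hc]; field_simp; ring
  have hlt : v.valuation K (x ^ 2 - (a' : K) * y ^ 2 - c) < v.valuation K 4 * v.valuation K (c : K) := by
    rw [e1, Valuation.map_neg, map_mul]
    by_cases hy : y = 0
    · subst hy
      simp [zero_lt_iff, v4_ne]
    have hy' : 0 < v.valuation K ((a : K) * y ^ 2) := by simp [zero_lt_iff, hy]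
    calc _ < v.valuation K ((a : K) * y ^ 2) * v.valuation K 16 := by gcongr
      _ = v.valuation K 4 * (v.valuation K 4 * v.valuation K ((a : K) * y ^ 2)) := by
        rw [h16]; ac_rfl
      _ ≤ _ := by rw [hc]; gcongr
  have hne : x ^ 2 - (a' : K) * y ^ 2 ≠ 0 := by
    intro h0
    rw [h0, zero_sub, Valuation.map_neg] at hlt
    exact absurd hlt (not_lt.2 (mul_le_of_le_one_left' (v4_le v)))
  have hw : Units.mk0 _ hne / c ∈ W v := div_mem_W (by simpa using hlt)
  refine mem_Ng.2 ⟨Units.mk0 _ hne, ⟨x, y, rfl⟩, _, inv_mem hw, ?_⟩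
  simp

lemma Ng_symm {v : Pl K} (hv : v.valuation K 2 = 1) {a b : Kˣ} (hb : b ∉ Sq v)
    (h : b ∈ Ng v (a : K)) : a ∈ Ng v (b : K) := by
  have h4 : v.valuation K 4 = 1 := by rw [v4_eq, hv, one_pow]
  obtain ⟨n, ⟨x, y, hn⟩, w, hw, rfl⟩ := mem_Ng.1 h
  have hnw : ((n * w : Kˣ) : K) = (x ^ 2 - a * y ^ 2) * w := by push_cast; rw [hn]
  have hy : y ≠ 0 := by
    rintro rfl
    apply hb
    have hx : x ≠ 0 := by
      rintro rfl
      simp at hn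
    refine mem_Sq.2 ⟨Units.mk0 x hx, w, hw, ?_⟩
    ext
    simp [hn]
  have hge := norm_ge hb x 1
  rw [h4, one_mul, one_pow, mul_one] at hge
  have e : x ^ 2 - ((n * w : Kˣ) : K) - a * y ^ 2 = n * (1 - w) := by
    rw [Units.val_mul, hn]; ring
  have hlt : v.valuation K (x ^ 2 - ((n * w : Kˣ) : K) - a * y ^ 2)
      < v.valuation K (x ^ 2 - ((n * w : Kˣ) : K)) := by
    rw [e, map_mul, Valuation.map_sub_swap]
    refine lt_of_lt_of_le ?_ hge
    rw [Units.val_mul, map_mul, W_val hw]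
    have : 0 < v.valuation K (n : K) := by simp [zero_lt_iff]
    gcongr
    have := mem_W.1 hw
    rwa [h4] at this
  have heq : v.valuation K ((a : K) * y ^ 2) = v.valuation K (x ^ 2 - ((n * w : Kˣ) : K)) := by
    have := Valuation.map_sub_eq_of_lt_left (v.valuation K) hlt
    rw [← this]; congr 1; ring
  have hne : x ^ 2 - ((n * w : Kˣ) : K) ≠ 0 := by
    intro h0
    rw [h0] at hlt; simp at hlt
  have hw' : Units.mk0 _ hne / (a * (Units.mk0 y hy) ^ 2) ∈ W v := by
    apply div_mem_W
    simp only [Units.val_mk0, Units.val_mul, Units.val_pow_eq_pow_val] at *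
    rw [h4, one_mul, heq]; exact hlt
  have h1 : a * (Units.mk0 y hy) ^ 2 ∈ Ng v ((n * w : Kˣ) : K) := by
    refine mem_Ng.2 ⟨Units.mk0 _ hne, ⟨x, 1, by simp⟩, _, inv_mem hw', ?_⟩
    simp
  have h2 := Sq_le_Ng v ((n * w : Kˣ) : K) (sq_mem_Sq v (Units.mk0 y hy))
  exact (Subgroup.mul_mem_cancel_right _ h2).1 h1

lemma le_exp_pred {x : ℤᵐ⁰} {m : ℤ} (h : x < exp m) : x ≤ exp (m - 1) := by
  by_cases hx : x = 0
  · simp [hx]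
  · rw [← exp_log hx] at h ⊢
    rw [exp_lt_exp] at h
    rw [exp_le_exp]; omega

/-- Newton iteration -/
lemma newton {v : Pl K} {w : Kˣ} (hw : w ∈ W v) (n : ℕ) :
    ∃ z w' : Kˣ, w = z ^ 2 * w' ∧
      v.valuation K ((w' : K) - 1) ≤ v.valuation K 4 * exp (-(n + 1) : ℤ) := by
  induction n with
  | zero =>
    refine ⟨1, w, by simp, ?_⟩
    have hw := mem_W.1 hw
    have hm : v.valuation K (((w : K) - 1) / 4) < 1 := by
      rw [map_div₀]; exact (div_lt_one₀ (zero_lt_iff.2 (v4_ne v))).2 hw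
    have h5 : v.valuation K (((w : K) - 1) / 4) ≤ exp (-1 : ℤ) := by
      rw [← exp_zero] at hm
      exact le_exp_pred hm
    have : v.valuation K ((w : K) - 1) = v.valuation K 4 * v.valuation K (((w : K) - 1) / 4) := by
      rw [← map_mul]; congr 1; field_simp
    rw [this]
    simpa using mul_le_mul_right h5 (v.valuation K 4)
  | succ n ih =>
    obtain ⟨z, w', h, hv⟩ := ih
    set t : K := ((w' : K) - 1) / 4 with ht
    have hwt : (w' : K) = 1 + 4 * t := by rw [ht]; field_simp; ring
    have htv : v.valuation K t ≤ exp (-(n + 1) : ℤ) := by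
      rw [ht, map_div₀, div_le_iff₀ (zero_lt_iff.2 (v4_ne v)), mul_comm]; exact hv
    have ht1 : v.valuation K t < 1 := by
      refine htv.trans_lt ?_
      rw [← exp_zero, exp_lt_exp]; omega
    have h1 : v.valuation K (1 + 2 * t) = 1 := by
      apply val_one_of_lt
      rw [add_sub_cancel_left, map_mul]
      exact lt_of_le_of_lt (mul_le_of_le_one_left' (v2_le v)) ht1
    have hne : 1 + 2 * t ≠ 0 := by
      intro h0; rw [h0] at h1; simp at h1
    refine ⟨z * Units.mk0 _ hne, w' / (Units.mk0 _ hne) ^ 2, ?_, ?_⟩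
    · rw [h, mul_pow, mul_assoc, mul_div_cancel]
    · have : ((w' / (Units.mk0 _ hne) ^ 2 : Kˣ) : K) - 1 = 4 * (- (t * t) / (1 + 2 * t) ^ 2) := by
        push_cast
        rw [Units.val_mk0, hwt, div_sub_one (pow_ne_zero 2 hne), ← mul_div_assoc]
        ring
      rw [this, map_mul, map_div₀, Valuation.map_neg, map_pow, h1, one_pow, div_one, map_mul]
      gcongr
      calc _ ≤ exp (-(n + 1) : ℤ) * exp (-(n + 1) : ℤ) := by gcongr
        _ ≤ _ := by rw [← exp_add, exp_le_exp]; push_cast; omega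

lemma exp_small {v : Pl K} (x : K) (hx : x ≠ 0) :
    ∃ n : ℕ, v.valuation K 4 * exp (-(n + 1) : ℤ) < v.valuation K x := by
  have hx' : v.valuation K x ≠ 0 := by simpa using hx
  obtain ⟨m, hm⟩ : ∃ m : ℤ, v.valuation K x = exp m := ⟨_, (exp_log hx').symm⟩
  refine ⟨m.natAbs, ?_⟩
  calc _ ≤ 1 * exp (-(m.natAbs + 1) : ℤ) := by gcongr; exact v4_le v
    _ < _ := by rw [one_mul, hm, exp_lt_exp]; omega

/-- local squares approximated to any precision -/
lemma Sq_approx {v : Pl K} {c : Kˣ} (hc : c ∈ Sq v) (x : K) (hx : x ≠ 0) :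
    ∃ z w : Kˣ, c = z ^ 2 * w ∧ v.valuation K ((w : K) - 1) < v.valuation K x := by
  obtain ⟨z, w, hw, rfl⟩ := mem_Sq.1 hc
  obtain ⟨n, hn⟩ := exp_small (v := v) x hx
  obtain ⟨z', w', rfl, h⟩ := newton hw n
  exact ⟨z * z', w', by rw [mul_pow, mul_assoc], h.trans_lt hn⟩

end CQ

namespace CQ
open IsDedekindDomain NumberField WithZero
universe u
set_option linter.unusedSectionVars false
set_option linter.unusedSimpArgs false
set_option linter.unusedVariables false
variable {K : Type u} [Field K] [NumberField K]

lemma coe_two : ((2 : 𝓞 K) : K) = 2 := map_ofNat (algebraMap (𝓞 K) K) 2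

lemma exists_unif (v : Pl K) : ∃ p : Kˣ, v.valuation K (p : K) = exp (-1 : ℤ) := by
  obtain ⟨p, hp⟩ := v.valuation_exists_uniformizer K
  have : p ≠ 0 := by
    rintro rfl
    simp at hp
    exact exp_ne_zero hp.symm
  exact ⟨Units.mk0 p this, hp⟩

/-- integral approximation -/
lemma exists_int_approx (v : Pl K) {x y : K} (hx : v.valuation K x ≤ 1) (hy : y ≠ 0) :
    ∃ r : 𝓞 K, v.valuation K (x - r) < v.valuation K y := by
  have hy' : v.valuation K y ≠ 0 := by simpa using hy
  obtain ⟨r, hr⟩ := HeightOneSpectrum.exists_valuation_sub_lt_of_integer v hx (γ := Units.mk0 _ hy')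
  refine ⟨r, ?_⟩
  rw [Valuation.map_sub_swap]
  simpa using hr

lemma val_even {v : Pl K} {x : Kˣ} : ∃ (z : Kˣ) (e : ℕ), e < 2 ∧
    v.valuation K ((x * z ^ 2 : Kˣ) : K) = exp (-(e : ℤ)) := by
  obtain ⟨p, hp⟩ := exists_unif v
  have hx : v.valuation K (x : K) ≠ 0 := by simp
  obtain ⟨m, hm⟩ : ∃ m : ℤ, v.valuation K (x : K) = exp m := ⟨_, (exp_log hx).symm⟩
  refine ⟨p ^ ((m + 1) / 2), ((-m) % 2).toNat, by omega, ?_⟩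
  push_cast
  rw [map_mul, map_pow, map_zpow₀, hp, hm, ← exp_zsmul, ← exp_nsmul, ← exp_add, exp_inj]
  simp
  omega

/-- for odd `v`, local unit that is a square of residue field is a local square -/
lemma odd_unit_Sq {v : Pl K} (hv : v.valuation K 2 = 1) {x : Kˣ} (hx : v.valuation K (x : K) = 1)
    {z : K} (h : v.valuation K (z ^ 2 - x) < 1) : x ∈ Sq v := by
  apply mem_Sq_of_lt (z := z)
  rwa [v4_eq, hv, hx, one_pow, one_mul]

noncomputable instance resField (v : Pl K) : Field (𝓞 K ⧸ v.asIdeal) :=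
  @Ideal.Quotient.field _ _ v.asIdeal v.isMaximal

instance resFinite (v : Pl K) : Finite (𝓞 K ⧸ v.asIdeal) :=
  Ideal.finiteQuotientOfFreeOfNeBot v.asIdeal v.ne_bot

lemma val_lt_iff (v : Pl K) (r : 𝓞 K) : v.valuation K (r : K) < 1 ↔
    Ideal.Quotient.mk v.asIdeal r = 0 := by
  rw [Ideal.Quotient.eq_zero_iff_mem]
  exact v.valuation_lt_one_iff_mem r

lemma two_ne (v : Pl K) (hv : v.valuation K 2 = 1) : (2 : 𝓞 K ⧸ v.asIdeal) ≠ 0 := by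
  intro h
  have : Ideal.Quotient.mk v.asIdeal (2 : 𝓞 K) = 0 := by rw [← h]; exact map_ofNat _ 2
  rw [← val_lt_iff, coe_two, hv] at this
  exact lt_irrefl _ this

/-- integral representative of local unit -/
lemma unit_rep (v : Pl K) {x : Kˣ} (hx : v.valuation K (x : K) = 1) :
    ∃ r : 𝓞 K, v.valuation K ((x : K) - r) < 1 ∧ Ideal.Quotient.mk v.asIdeal r ≠ 0 := by
  obtain ⟨r, hr⟩ := exists_int_approx v (x := (x : K)) (y := 1) hx.le one_ne_zero
  rw [map_one] at hr
  refine ⟨r, hr, ?_⟩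
  rw [Ne, ← val_lt_iff]
  intro h
  have := Valuation.map_add_lt _ hr h
  rw [sub_add_cancel, hx] at this
  exact lt_irrefl _ this

lemma odd_Sq_of_res {v : Pl K} (hv : v.valuation K 2 = 1) {x : Kˣ}
    (hx : v.valuation K (x : K) = 1) {r : 𝓞 K} (hr : v.valuation K ((x : K) - r) < 1)
    (h : IsSquare (Ideal.Quotient.mk v.asIdeal r)) : x ∈ Sq v := by
  obtain ⟨s, hs⟩ := h
  obtain ⟨s, rfl⟩ := Ideal.Quotient.mk_surjective s
  apply odd_unit_Sq hv hx (z := s)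
  rw [← map_mul, ← sub_eq_zero, ← map_sub, ← val_lt_iff] at hs
  have : (s : K) ^ 2 - x = - (((r - s * s : 𝓞 K) : K) + ((x : K) - r)) := by
    push_cast; ring
  rw [this, Valuation.map_neg]
  exact Valuation.map_add_lt _ hs hr

lemma odd_mul_Sq {v : Pl K} (hv : v.valuation K 2 = 1) {x y : Kˣ}
    (hx : v.valuation K (x : K) = 1) (hy : v.valuation K (y : K) = 1) (hxs : x ∉ Sq v)
    (hys : y ∉ Sq v) : x * y ∈ Sq v := by
  classical
  obtain ⟨r, hr, hr0⟩ := unit_rep v hx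
  obtain ⟨s, hs, hs0⟩ := unit_rep v hy
  have : Fintype (𝓞 K ⧸ v.asIdeal) := Fintype.ofFinite _
  have hF : ringChar (𝓞 K ⧸ v.asIdeal) ≠ 2 := by
    intro h
    apply two_ne v hv
    have := ringChar.Nat.cast_ringChar (R := 𝓞 K ⧸ v.asIdeal)
    rw [h] at this
    exact_mod_cast this
  have h1 : ¬ IsSquare (Ideal.Quotient.mk v.asIdeal r) := fun h => hxs (odd_Sq_of_res hv hx hr h)
  have h2 : ¬ IsSquare (Ideal.Quotient.mk v.asIdeal s) := fun h => hys (odd_Sq_of_res hv hy hs h)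
  have hr1 : v.valuation K (r : K) ≤ 1 := v.valuation_le_one r
  refine odd_Sq_of_res hv (r := r * s) (by push_cast; rw [map_mul, hx, hy, one_mul]) ?_ ?_
  · have : ((x * y : Kˣ) : K) - ((r * s : 𝓞 K) : K) = ((x : K) - r) * y + r * ((y : K) - s) := by
      push_cast; ring
    rw [this]
    refine Valuation.map_add_lt _ ?_ ?_
    · rwa [map_mul, hy, mul_one]
    · rw [map_mul]; exact lt_of_le_of_lt (mul_le_of_le_one_left' hr1) hs
  · rw [map_mul]
    have e1 := quadraticChar_neg_one_iff_not_isSquare.2 h1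
    have e2 := quadraticChar_neg_one_iff_not_isSquare.2 h2
    rw [← quadraticChar_one_iff_isSquare (mul_ne_zero hr0 hs0), map_mul, e1, e2]
    norm_num

/-- nontrivial unit class for odd places -/
lemma odd_exists_nonsq {v : Pl K} (hv : v.valuation K 2 = 1) :
    ∃ x : Kˣ, v.valuation K (x : K) = 1 ∧ ∀ z : K, ¬ v.valuation K ((x : K) - z ^ 2) < 1 := by
  have : Fintype (𝓞 K ⧸ v.asIdeal) := Fintype.ofFinite _
  have hF : ringChar (𝓞 K ⧸ v.asIdeal) ≠ 2 := by
    intro h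
    apply two_ne v hv
    have := ringChar.Nat.cast_ringChar (R := 𝓞 K ⧸ v.asIdeal)
    rw [h] at this
    exact_mod_cast this
  obtain ⟨a, ha⟩ := FiniteField.exists_nonsquare hF
  obtain ⟨r, rfl⟩ := Ideal.Quotient.mk_surjective a
  have hr0 : Ideal.Quotient.mk v.asIdeal r ≠ 0 := by
    intro h; rw [h] at ha; exact ha IsSquare.zero
  have hr1 : v.valuation K (r : K) = 1 := by
    refine le_antisymm (v.valuation_le_one r) (not_lt.1 ?_)
    rwa [val_lt_iff]
  have hrne : (r : K) ≠ 0 := by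
    intro h; rw [h] at hr1; simp at hr1
  refine ⟨Units.mk0 _ hrne, hr1, fun z hz => ha ?_⟩
  rw [Units.val_mk0] at hz
  have hz1 : v.valuation K z ≤ 1 := by
    by_contra! h
    have h2 : 1 < v.valuation K (z ^ 2) := by rw [map_pow]; exact one_lt_pow₀ h (by norm_num)
    rw [Valuation.map_sub_eq_of_lt_right _ (by rwa [hr1])] at hz
    exact absurd hz (not_lt.2 h2.le)
  obtain ⟨s, hs⟩ := exists_int_approx v hz1 (y := 1) one_ne_zero
  rw [map_one] at hs
  refine ⟨Ideal.Quotient.mk v.asIdeal s, ?_⟩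
  rw [← map_mul, ← sub_eq_zero, ← map_sub, ← val_lt_iff]
  have : ((r - s * s : 𝓞 K) : K) = ((r : K) - z ^ 2) + (z - s) * (z + s) := by push_cast; ring
  rw [this]
  refine Valuation.map_add_lt _ hz ?_
  rw [map_mul]
  exact lt_of_le_of_lt (mul_le_of_le_one_right' (Valuation.map_add_le _ hz1 (v.valuation_le_one s))) hs

lemma odd_norm_ge {v : Pl K} (hv : v.valuation K 2 = 1) {a : Kˣ} (ha : a ∉ Sq v) (x y : K) :
    v.valuation K (x ^ 2 - a * y ^ 2) = max (v.valuation K (x ^ 2)) (v.valuation K (a * y ^ 2)) := by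
  have h1 := norm_ge ha x y
  rw [v4_eq, hv, one_pow, one_mul] at h1
  have h2 : v.valuation K (x ^ 2) ≤ v.valuation K (x ^ 2 - a * y ^ 2) := by
    have := Valuation.map_add_le _ le_rfl h1
    rwa [sub_add_cancel] at this
  exact le_antisymm (Valuation.map_sub _ _ _) (max_le h2 h1)

lemma Ng_ne_top {v : Pl K} (hv : v.valuation K 2 = 1) {a : Kˣ} (ha : a ∉ Sq v) :
    Ng v (a : K) ≠ ⊤ := by
  intro htop
  have h4 : v.valuation K 4 = 1 := by rw [v4_eq, hv, one_pow]
  -- every element has valuation of a norm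
  have key : ∀ c : Kˣ, ∃ x y : K, v.valuation K ((c : K) - (x ^ 2 - a * y ^ 2)) < v.valuation K (c : K) ∧
      v.valuation K (c : K) = v.valuation K (x ^ 2 - a * y ^ 2) := by
    intro c
    obtain ⟨n, ⟨x, y, hn⟩, w, hw, rfl⟩ := mem_Ng.1 (htop ▸ Subgroup.mem_top c)
    have hw1 := W_val hw
    refine ⟨x, y, ?_, ?_⟩
    · rw [← hn]
      have : ((n * w : Kˣ) : K) - n = n * (w - 1) := by push_cast; ring
      rw [this, Units.val_mul, map_mul, map_mul, hw1]
      have h0 : 0 < v.valuation K (n : K) := by simp [zero_lt_iff]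
      gcongr
      have := mem_W.1 hw
      rwa [h4] at this
    · rw [Units.val_mul, map_mul, hw1, mul_one, hn]
  have hsq : ∀ x : K, v.valuation K (x ^ 2) = v.valuation K x ^ 2 := fun x => map_pow _ _ _
  obtain ⟨z, e, he, hz⟩ := val_even (v := v) (x := a)
  have hodd : ∀ (y : K), v.valuation K (a * y ^ 2) =
      exp (-(e : ℤ)) * (v.valuation K (y / z)) ^ 2 := by
    intro y
    rw [← hz, ← map_pow, ← map_mul]
    congr 1
    push_cast
    field_simp
  have par : ∀ y : K, y ≠ 0 → ∃ m : ℤ, v.valuation K y = exp m := fun y hy =>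
    ⟨_, (exp_log (by simpa using hy)).symm⟩
  interval_cases e
  · -- even case : take uniformizer
    obtain ⟨p, hp⟩ := exists_unif v
    obtain ⟨x, y, -, h⟩ := key p
    rw [odd_norm_ge hv ha, hodd, hsq, hp] at h
    have hh : ∀ t : K, v.valuation K t ^ 2 ≠ exp (-1 : ℤ) := by
      intro t ht
      by_cases ht0 : t = 0
      · simp [ht0] at ht
        exact absurd ht.symm exp_ne_zero
      obtain ⟨m, hm⟩ := par t ht0
      rw [hm, ← exp_nsmul, exp_inj] at ht
      simp at ht; omega
    rcases max_choice (v.valuation K x ^ 2) (exp (-((0 : ℕ) : ℤ)) * v.valuation K (y / z) ^ 2) with h' | h'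
    · rw [h'] at h; exact hh _ h.symm
    · rw [h'] at h; simp only [Nat.cast_zero, neg_zero, exp_zero, one_mul] at h; exact hh _ h.symm
  · obtain ⟨c, hc, hc'⟩ := odd_exists_nonsq hv
    obtain ⟨x, y, hlt, h⟩ := key c
    rw [odd_norm_ge hv ha, hc] at h
    have h1 : v.valuation K (a * y ^ 2) ≤ 1 := h ▸ le_max_right _ _
    have h2 : v.valuation K (a * y ^ 2) ≠ 1 := by
      rw [hodd]
      by_cases hy : y / z = 0
      · simp [hy]
      obtain ⟨m, hm⟩ := par _ hy
      rw [hm, ← exp_nsmul, ← exp_add, ← exp_zero, Ne, exp_inj]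
      simp; omega
    apply hc' x
    have : (c : K) - x ^ 2 = ((c : K) - (x ^ 2 - a * y ^ 2)) - a * y ^ 2 := by ring
    rw [this]
    refine Valuation.map_sub_lt _ ?_ (lt_of_le_of_ne h1 h2)
    rwa [hc] at hlt

/-- good places: units are norms -/
lemma unit_mem_Ng {v : Pl K} (hv : v.valuation K 2 = 1) {a b : Kˣ}
    (ha : v.valuation K (a : K) = 1) (hb : v.valuation K (b : K) = 1) : b ∈ Ng v (a : K) := by
  by_cases hbs : b ∈ Sq v
  · exact Sq_le_Ng _ _ hbs
  have : Fintype (𝓞 K ⧸ v.asIdeal) := Fintype.ofFinite _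
  obtain ⟨r, hr, hr0⟩ := unit_rep v ha
  obtain ⟨s, hs, hs0⟩ := unit_rep v hb
  obtain ⟨x, y, hxy⟩ : ∃ x y : 𝓞 K ⧸ v.asIdeal, x ^ 2 - Ideal.Quotient.mk v.asIdeal r * y ^ 2 =
      Ideal.Quotient.mk v.asIdeal s := by
    have hF : ringChar (𝓞 K ⧸ v.asIdeal) ≠ 2 := by
      intro h
      apply two_ne v hv
      have := ringChar.Nat.cast_ringChar (R := 𝓞 K ⧸ v.asIdeal)
      rw [h] at this
      exact_mod_cast this
    have hodd : Fintype.card (𝓞 K ⧸ v.asIdeal) % 2 = 1 := FiniteField.odd_card_of_char_ne_two hF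
    open Polynomial in
    obtain ⟨x, y, h⟩ := FiniteField.exists_root_sum_quadratic
      (f := (X ^ 2 : (𝓞 K ⧸ v.asIdeal)[X]))
      (g := C (- Ideal.Quotient.mk v.asIdeal r) * X ^ 2 - C (Ideal.Quotient.mk v.asIdeal s))
      (by simp) (by
        rw [sub_eq_add_neg, ← C_neg]
        compute_degree!) hodd
    refine ⟨x, y, ?_⟩
    simp at h
    linear_combination h
  obtain ⟨x, rfl⟩ := Ideal.Quotient.mk_surjective x
  obtain ⟨y, rfl⟩ := Ideal.Quotient.mk_surjective y
  rw [← map_pow, ← map_pow, ← map_mul, ← map_sub, ← sub_eq_zero, ← map_sub, ← val_lt_iff] at hxy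
  have hlt : v.valuation K (((x : K) ^ 2 - a * (y : K) ^ 2) - b) < 1 := by
    have : ((x : K) ^ 2 - a * (y : K) ^ 2) - b = ((x ^ 2 - r * y ^ 2 - s : 𝓞 K) : K) -
        ((a : K) - r) * ((y ^ 2 : 𝓞 K) : K) - ((b : K) - s) := by
      push_cast; ring
    rw [this]
    refine Valuation.map_sub_lt _ (Valuation.map_sub_lt _ hxy ?_) hs
    rw [map_mul]
    exact lt_of_le_of_lt (mul_le_of_le_one_right' (v.valuation_le_one _)) hr
  have hne : (x : K) ^ 2 - a * (y : K) ^ 2 ≠ 0 := by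
    intro h
    rw [h, zero_sub, Valuation.map_neg, hb] at hlt
    exact lt_irrefl _ hlt
  have hw : Units.mk0 _ hne / b ∈ W v := by
    apply div_mem_W
    rw [v4_eq, hv, hb, one_pow, one_mul]; exact hlt
  refine mem_Ng.2 ⟨Units.mk0 _ hne, ⟨x, y, rfl⟩, _, inv_mem hw, ?_⟩
  simp

end CQ

namespace CQ
open IsDedekindDomain NumberField WithZero
universe u
set_option linter.unusedSectionVars false
set_option linter.unusedSimpArgs false
set_option linter.unusedVariables false
set_option linter.style.haveILetI false
variable {K : Type u} [Field K] [NumberField K]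

lemma mem_pow_iff (v : Pl K) (r : 𝓞 K) (n : ℕ) :
    r ∈ v.asIdeal ^ n ↔ v.valuation K (r : K) ≤ exp (-(n : ℤ)) := by
  rw [← v.intValuation_le_pow_iff_mem]
  have : v.valuation K (r : K) = v.intValuation r := v.valuation_of_algebraMap r
  rw [this]

lemma exists_e (v : Pl K) : ∃ e : ℕ, v.valuation K 2 = exp (-(e : ℤ)) := by
  have h2 : v.valuation K 2 ≠ 0 := by simp
  have h1 := v2_le v
  refine ⟨(-(log (v.valuation K 2))).toNat, ?_⟩
  have h3 : log (v.valuation K 2) ≤ 0 := by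
    rw [← exp_log h2, ← exp_zero, exp_le_exp] at h1; exact h1
  conv_lhs => rw [← exp_log h2]
  congr 1
  omega

/-- ramification exponent of 2 -/
noncomputable def e2 (v : Pl K) : ℕ := (exists_e v).choose

lemma e2_spec (v : Pl K) : v.valuation K 2 = exp (-(e2 v : ℤ)) := (exists_e v).choose_spec

lemma card_sq_quot (G : Type*) [CommGroup G] [Finite G] :
    Nat.card (G ⧸ (powMonoidHom 2 : G →* G).range) = Nat.card (powMonoidHom 2 : G →* G).ker := by
  have h1 := Subgroup.card_eq_card_quotient_mul_card_subgroup (powMonoidHom 2 : G →* G).range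
  have h2 := Subgroup.card_eq_card_quotient_mul_card_subgroup (powMonoidHom 2 : G →* G).ker
  have h3 : Nat.card (G ⧸ (powMonoidHom 2 : G →* G).ker) = Nat.card (powMonoidHom 2 : G →* G).range :=
    Nat.card_congr (QuotientGroup.quotientKerEquivRange _).toEquiv
  rw [h3, h1, mul_comm] at h2
  exact Nat.eq_of_mul_eq_mul_left Nat.card_pos h2

instance finQ (v : Pl K) (n : ℕ) : Finite (𝓞 K ⧸ v.asIdeal ^ n) :=
  Ideal.finiteQuotientOfFreeOfNeBot _ (pow_ne_zero n v.ne_bot)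

lemma card_Q (v : Pl K) (n : ℕ) :
    Nat.card (𝓞 K ⧸ v.asIdeal ^ n) = (Ideal.absNorm v.asIdeal) ^ n := by
  have : Ideal.absNorm (v.asIdeal ^ n) = (Ideal.absNorm v.asIdeal) ^ n := map_pow _ _ _
  rw [← this]; rfl

lemma absNorm_pos (v : Pl K) : 0 < Ideal.absNorm v.asIdeal := by
  rw [Nat.pos_iff_ne_zero, Ne, Ideal.absNorm_eq_zero_iff]; exact v.ne_bot

lemma card_ker_factor (v : Pl K) {m n : ℕ} (h : m ≤ n) :
    Nat.card (Ideal.Quotient.factor (Ideal.pow_le_pow_right h : v.asIdeal ^ n ≤ v.asIdeal ^ m)).toAddMonoidHom.ker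
      = (Ideal.absNorm v.asIdeal) ^ (n - m) := by
  set f := (Ideal.Quotient.factor (Ideal.pow_le_pow_right h : v.asIdeal ^ n ≤ v.asIdeal ^ m)).toAddMonoidHom
  have h2 := AddSubgroup.card_eq_card_quotient_mul_card_addSubgroup f.ker
  have h3 : Nat.card ((𝓞 K ⧸ v.asIdeal ^ n) ⧸ f.ker) = Nat.card (𝓞 K ⧸ v.asIdeal ^ m) :=
    Nat.card_congr (QuotientAddGroup.quotientKerEquivOfSurjective f
      (Ideal.Quotient.factor_surjective (Ideal.pow_le_pow_right h))).toEquiv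
  rw [h3, card_Q, card_Q] at h2
  apply Nat.eq_of_mul_eq_mul_left (pow_pos (absNorm_pos v) m)
  rw [← h2, ← pow_add, Nat.add_sub_cancel' h]

lemma card_two_tors (v : Pl K) :
    Nat.card (powMonoidHom 2 : (𝓞 K ⧸ v.asIdeal ^ (2 * e2 v + 1))ˣ →* _).ker
      ≤ 2 * (Ideal.absNorm v.asIdeal) ^ (e2 v) := by
  classical
  set n := 2 * e2 v + 1 with hn
  set m := e2 v + 1 with hm
  have hmn : m ≤ n := by omega
  set f := (Ideal.Quotient.factor (Ideal.pow_le_pow_right hmn : v.asIdeal ^ n ≤ v.asIdeal ^ m)).toAddMonoidHom with hf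
  have hmk : ∀ r : 𝓞 K, (Ideal.Quotient.mk (v.asIdeal ^ n) r) ∈ f.ker ↔ r ∈ v.asIdeal ^ m := by
    intro r
    rw [AddMonoidHom.mem_ker]
    change (Ideal.Quotient.factor (Ideal.pow_le_pow_right hmn)) (Ideal.Quotient.mk (v.asIdeal ^ n) r) = 0 ↔ _
    rw [Ideal.Quotient.factor_mk, Ideal.Quotient.eq_zero_iff_mem]
  have hc := card_ker_factor v hmn
  have : e2 v = n - m := by omega
  rw [this, ← hc]
  have key : ∀ x : (𝓞 K ⧸ v.asIdeal ^ n)ˣ, x ∈ (powMonoidHom 2 : (𝓞 K ⧸ v.asIdeal ^ n)ˣ →* _).ker →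
      (x : 𝓞 K ⧸ v.asIdeal ^ n) - 1 ∉ f.ker → (x : 𝓞 K ⧸ v.asIdeal ^ n) + 1 ∈ f.ker := by
    intro x hx h1
    have hx2 : (x : 𝓞 K ⧸ v.asIdeal ^ n) ^ 2 = 1 := by
      have := MonoidHom.mem_ker.1 hx
      have := congrArg Units.val this
      simpa using this
    obtain ⟨r, hr⟩ := Ideal.Quotient.mk_surjective (x : 𝓞 K ⧸ v.asIdeal ^ n)
    rw [← hr] at hx2 h1 ⊢
    rw [← map_one (Ideal.Quotient.mk _), ← map_sub, hmk, mem_pow_iff] at h1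
    rw [← map_one (Ideal.Quotient.mk _), ← map_add, hmk, mem_pow_iff]
    rw [← map_one (Ideal.Quotient.mk _), ← map_pow, ← sub_eq_zero, ← map_sub,
      Ideal.Quotient.eq_zero_iff_mem, mem_pow_iff] at hx2
    have e1 : ((r ^ 2 - 1 : 𝓞 K) : K) = ((r - 1 : 𝓞 K) : K) * ((r + 1 : 𝓞 K) : K) := by push_cast; ring
    rw [e1, map_mul] at hx2
    rw [not_le] at h1
    by_contra! h2
    by_cases h30 : v.valuation K ((r - 1 : 𝓞 K) : K) = 0
    · rw [h30] at h1; simp at h1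
    by_cases h40 : v.valuation K ((r + 1 : 𝓞 K) : K) = 0
    · rw [h40] at h2; simp at h2
    rw [← exp_log h30, ← exp_log h40, ← exp_add, exp_le_exp] at hx2
    rw [← exp_log h30, exp_lt_exp] at h1
    rw [← exp_log h40, exp_lt_exp] at h2
    omega
  have hinj : Function.Injective (fun x : (powMonoidHom 2 : (𝓞 K ⧸ v.asIdeal ^ n)ˣ →* _).ker =>
      if h : ((x : (𝓞 K ⧸ v.asIdeal ^ n)ˣ) : 𝓞 K ⧸ v.asIdeal ^ n) - 1 ∈ f.ker then
        ((0 : Fin 2), (⟨_, h⟩ : f.ker)) else (1, ⟨_, key x x.2 h⟩)) := by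
    intro x y hxy
    simp only at hxy
    split_ifs at hxy with h1 h2 h2
    · simp only [Prod.mk.injEq, Subtype.mk.injEq, sub_left_inj, true_and] at hxy
      exact Subtype.ext (Units.ext hxy)
    · simp at hxy
    · simp at hxy
    · simp only [Prod.mk.injEq, Subtype.mk.injEq, add_left_inj, true_and] at hxy
      exact Subtype.ext (Units.ext hxy)
  have := Nat.card_le_card_of_injective _ hinj
  rw [Nat.card_prod, Nat.card_eq_fintype_card (α := Fin 2), Fintype.card_fin] at this
  exact this

/-- Bound on local square classes. -/
lemma Sq_index (v : Pl K) : Finite (Kˣ ⧸ Sq v) ∧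
    (Sq v).index ≤ 4 * (Ideal.absNorm v.asIdeal) ^ (e2 v) := by
  classical
  set n := 2 * e2 v + 1 with hn
  set G := (𝓞 K ⧸ v.asIdeal ^ n)ˣ with hG
  obtain ⟨p, hp⟩ := exists_unif v
  haveI := v.isMaximal
  have hn0 : n ≠ 0 := by omega
  have h4 : v.valuation K 4 = exp (-(2 * e2 v : ℕ) : ℤ) := by
    rw [v4_eq, e2_spec, ← exp_nsmul]; congr 1; push_cast; simp
  have hunit : ∀ r : 𝓞 K, IsUnit (Ideal.Quotient.mk (v.asIdeal ^ n) r) ↔ v.valuation K (r : K) = 1 := by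
    intro r
    rw [Ideal.Quotient.isUnit_mk_pow_iff_notMem _ hn0]
    exact v.valuation_eq_one_iff_notMem.symm
  have hlift : ∀ g : G, ∃ r : 𝓞 K, Ideal.Quotient.mk (v.asIdeal ^ n) r = g ∧ v.valuation K (r : K) = 1 ∧
      (r : K) ≠ 0 := by
    intro g
    obtain ⟨r, hr⟩ := Ideal.Quotient.mk_surjective (g : 𝓞 K ⧸ v.asIdeal ^ n)
    have : v.valuation K (r : K) = 1 := (hunit r).1 (hr ▸ g.isUnit)
    refine ⟨r, hr, this, ?_⟩
    intro h; rw [h] at this; simp at this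
  choose lift hl1 hl2 hl3 using hlift
  have hsurj : Function.Surjective (fun c : Fin 2 × (G ⧸ (powMonoidHom 2 : G →* G).range) =>
      (QuotientGroup.mk (p ^ (c.1 : ℕ) * Units.mk0 _ (hl3 c.2.out)) : Kˣ ⧸ Sq v)) := by
    intro x
    obtain ⟨x, rfl⟩ := QuotientGroup.mk_surjective x
    obtain ⟨z, i, hi, hz⟩ := val_even (v := v) (x := x)
    set y := x * z ^ 2 / p ^ i with hy
    have hy1 : v.valuation K (y : K) = 1 := by
      rw [hy, Units.val_div_eq_div_val, map_div₀, hz, Units.val_pow_eq_pow_val, map_pow, hp, ← exp_nsmul]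
      simp [exp_ne_zero]
    obtain ⟨r, hr⟩ := exists_int_approx v (x := (y : K)) (y := 4) hy1.le (by norm_num)
    have hr1 : v.valuation K (r : K) = 1 := by
      have h5 : v.valuation K ((y : K) - r) < v.valuation K (y : K) := by
        rw [hy1]; exact hr.trans_le (v4_le v)
      have := Valuation.map_sub_eq_of_lt_left _ h5
      rw [← hy1, ← this]; congr 1; ring
    set g : G := ((hunit r).2 hr1).unit with hg
    refine ⟨(⟨i, hi⟩, QuotientGroup.mk g), ?_⟩
    simp only
    obtain ⟨t, ht⟩ : ∃ t : G, g * t ^ 2 = (QuotientGroup.mk g : G ⧸ (powMonoidHom 2 : G →* G).range).out := by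
      obtain ⟨⟨_, t, rfl⟩, ht⟩ := QuotientGroup.mk_out_eq_mul (powMonoidHom 2 : G →* G).range g
      exact ⟨t, ht.symm⟩
    set o := (QuotientGroup.mk g : G ⧸ (powMonoidHom 2 : G →* G).range).out with ho
    set s := lift o with hs
    -- s ≡ r * lift t ^ 2
    have h6 : v.valuation K ((s - r * lift t ^ 2 : 𝓞 K) : K) < v.valuation K 4 := by
      have : s - r * lift t ^ 2 ∈ v.asIdeal ^ n := by
        rw [← Ideal.Quotient.eq_zero_iff_mem, map_sub, map_mul, map_pow, hl1, hl1, ← ht]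
        have : (g : 𝓞 K ⧸ v.asIdeal ^ n) = Ideal.Quotient.mk _ r := rfl
        rw [← this]
        rw [Units.val_mul, Units.val_pow_eq_pow_val, sub_self]
      rw [mem_pow_iff] at this
      refine this.trans_lt ?_
      rw [h4, exp_lt_exp]; omega
    have h7 : Units.mk0 _ (hl3 o) / (y * (Units.mk0 _ (hl3 t)) ^ 2) ∈ W v := by
      apply div_mem_W
      push_cast
      rw [map_mul, map_pow, hy1, Units.val_mk0, Units.val_mk0, hl2, one_pow, mul_one, mul_one]
      have : (lift o : K) - y * (lift t : K) ^ 2 = ((s - r * lift t ^ 2 : 𝓞 K) : K) - ((y : K) - r) * (lift t : K) ^ 2 := by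
        push_cast; ring
      rw [this]
      refine Valuation.map_sub_lt _ h6 ?_
      rw [map_mul, map_pow, hl2, one_pow, mul_one]; exact hr
    rw [eq_comm, QuotientGroup.eq]
    have h8 : x⁻¹ * (p ^ i * Units.mk0 _ (hl3 o)) =
        (Units.mk0 _ (hl3 o) / (y * (Units.mk0 _ (hl3 t)) ^ 2)) * (z * Units.mk0 _ (hl3 t)) ^ 2 := by
      rw [hy]
      ext
      push_cast
      have := hl3 t
      simp only [Units.val_mk0]
      field_simp
    rw [h8]
    exact mul_mem (W_le_Sq v h7) (sq_mem_Sq v _)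
  refine ⟨Finite.of_surjective _ hsurj, ?_⟩
  have h9 := Nat.card_le_card_of_surjective _ hsurj
  rw [Nat.card_prod, card_sq_quot] at h9
  have h10 := card_two_tors v
  rw [Subgroup.index]
  refine h9.trans ?_
  rw [Nat.card_eq_fintype_card, Fintype.card_fin]
  have h11 : Nat.card (powMonoidHom 2 : G →* G).ker ≤ 2 * Ideal.absNorm v.asIdeal ^ e2 v := h10
  linarith

lemma prod_index (S : Finset (Pl K)) :
    ∏ v ∈ S, (Sq v).index ≤ 4 ^ S.card * 2 ^ Module.finrank ℚ K := by
  classical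
  calc _ ≤ ∏ v ∈ S, 4 * (Ideal.absNorm v.asIdeal) ^ (e2 v) :=
        Finset.prod_le_prod' (fun v _ => (Sq_index v).2)
    _ = 4 ^ S.card * ∏ v ∈ S, (Ideal.absNorm v.asIdeal) ^ (e2 v) := by
        rw [Finset.prod_mul_distrib, Finset.prod_const]
    _ ≤ _ := by
      gcongr
      have hd : ∏ v ∈ S, v.asIdeal ^ (e2 v) ∣ Ideal.span {(2 : 𝓞 K)} := by
        apply Finset.prod_dvd_of_coprime
        · intro v _ w _ hvw
          apply IsCoprime.pow
          rw [Ideal.isCoprime_iff_sup_eq]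
          exact v.isMaximal.coprime_of_ne w.isMaximal (fun h => hvw (HeightOneSpectrum.ext h))
        · intro v _
          rw [Ideal.dvd_span_singleton, mem_pow_iff, coe_two, e2_spec]
      have h1 := map_dvd Ideal.absNorm hd
      have h2 : Ideal.absNorm (Ideal.span {(2 : 𝓞 K)}) = 2 ^ Module.finrank ℚ K := by
        rw [Ideal.absNorm_span_singleton]
        have : (2 : 𝓞 K) = algebraMap ℤ (𝓞 K) 2 := by simp
        rw [this, Algebra.norm_algebraMap, Int.natAbs_pow, RingOfIntegers.rank]
        norm_num
      rw [h2, map_prod] at h1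
      refine le_trans (le_of_eq ?_) (Nat.le_of_dvd (by positivity) h1)
      exact Finset.prod_congr rfl fun v _ => (map_pow _ _ _).symm

end CQ

namespace CQ
open IsDedekindDomain NumberField WithZero
universe u
set_option linter.unusedSectionVars false
set_option linter.unusedSimpArgs false
set_option linter.unusedVariables false
set_option linter.style.haveILetI false
variable {K : Type u} [Field K] [NumberField K]

lemma index_add (M : Type*) [AddCommGroup M] [Module.Finite ℤ M] :
    (nsmulAddMonoidHom (α := M) 2).range.index =
      2 ^ Module.finrank ℤ M * Nat.card (nsmulAddMonoidHom (α := M) 2).ker := by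
  haveI : AddGroup.FG M := Module.Finite.iff_addGroup_fg.1 inferInstance
  obtain ⟨n, ι, _, p, hp, e, ⟨f⟩⟩ := AddCommGroup.equiv_free_prod_directSum_zmod M
  set D := DirectSum ι fun i => ZMod (p i ^ e i) with hD
  haveI hne : ∀ i, NeZero (p i ^ e i) := fun i => ⟨pow_ne_zero _ (hp i).ne_zero⟩
  haveI : Finite D := Finite.of_equiv _ (DirectSum.addEquivProd fun i => ZMod (p i ^ e i)).symm.toEquiv
  set F := Fin n →₀ ℤ with hF
  have hFn : Module.finrank ℤ F = n := by
    show Module.finrank ℤ (Fin n →₀ ℤ) = n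
    simp
  have h1 : (nsmulAddMonoidHom (α := M) 2).range.index = (nsmulAddMonoidHom (α := F × D) 2).range.index := by
    rw [← AddSubgroup.index_map_equiv _ f, AddEquiv.map_range_nsmulAddMonoidHom]
  have h2 : (nsmulAddMonoidHom (α := F × D) 2).range =
      ((nsmulAddMonoidHom (α := F) 2).range).prod (nsmulAddMonoidHom (α := D) 2).range := by
    ext ⟨x, y⟩
    simp only [AddMonoidHom.mem_range, AddSubgroup.mem_prod, nsmulAddMonoidHom_apply, Prod.exists,
      Prod.smul_mk, Prod.mk.injEq]
    constructor
    · rintro ⟨a, b, h, h'⟩; exact ⟨⟨a, h⟩, b, h'⟩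
    · rintro ⟨⟨a, h⟩, b, h'⟩; exact ⟨a, b, h, h'⟩
  have h3 : (nsmulAddMonoidHom (α := F) 2).range.index = 2 ^ n := by
    rw [AddSubgroup.index_range_nsmul, hFn]
  have h4 : (nsmulAddMonoidHom (α := D) 2).range.index = Nat.card (nsmulAddMonoidHom (α := D) 2).ker :=
    card_sq_quot (Multiplicative D)
  have h5 : Nat.card (nsmulAddMonoidHom (α := M) 2).ker = Nat.card (nsmulAddMonoidHom (α := D) 2).ker := by
    refine Nat.card_congr ⟨fun x => ⟨(f x).2, ?_⟩, fun y => ⟨f.symm (0, y), ?_⟩, ?_, ?_⟩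
    · have : (2 : ℕ) • (x : M) = 0 := x.2
      show (2 : ℕ) • (f x).2 = 0
      rw [← Prod.smul_snd, ← map_nsmul, this]; simp
    · show (2 : ℕ) • f.symm (0, (y : D)) = 0
      have : (2 : ℕ) • (y : D) = 0 := y.2
      rw [← map_nsmul, Prod.smul_mk, this]; simp
    · intro x
      have h : (2 : ℕ) • (x : M) = 0 := x.2
      have h' : (2 : ℕ) • (f x).1 = 0 := by
        rw [← Prod.smul_fst, ← map_nsmul, h]; simp
      have h'' : (f x).1 = 0 := by
        simpa using h'
      ext
      simp only
      rw [AddEquiv.symm_apply_eq]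
      exact Prod.ext h''.symm rfl
    · intro y
      simp
  have h6 : Module.finrank ℤ M = n := by
    rw [f.toIntLinearEquiv.finrank_eq]
    have := (LinearMap.ker (LinearMap.fst ℤ F D)).finrank_quotient_add_finrank
    rw [(LinearMap.quotKerEquivOfSurjective (LinearMap.fst ℤ F D) LinearMap.fst_surjective).finrank_eq] at this
    rw [← this]
    have h7 : Module.finrank ℤ (LinearMap.ker (LinearMap.fst ℤ F D)) = 0 := by
      apply Module.IsTorsion.finrank_eq_zero
      rintro ⟨⟨x, y⟩, hx⟩
      have hx : x = 0 := hx
      subst hx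
      refine ⟨⟨(Nat.card D : ℤ), mem_nonZeroDivisors_of_ne_zero (by exact_mod_cast Nat.card_pos.ne')⟩, ?_⟩
      ext
      · simp
      · simp
    rw [h7, hFn, add_zero]
  rw [h1, h2, AddSubgroup.index_prod, h3, h4, h5, h6]

lemma index_mul (A : Type*) [CommGroup A] [Module.Finite ℤ (Additive A)] :
    (powMonoidHom 2 : A →* A).range.index =
      2 ^ Module.finrank ℤ (Additive A) * Nat.card (powMonoidHom 2 : A →* A).ker :=
  index_add (Additive A)

/-- S-units -/
noncomputable abbrev U (S : Finset (Pl K)) : Subgroup Kˣ := (S : Set (Pl K)).unit K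

lemma mem_U {S : Finset (Pl K)} {x : Kˣ} : x ∈ U S ↔ ∀ v ∉ S, v.valuation K (x : K) = 1 := Iff.rfl

lemma U_mono {S T : Finset (Pl K)} (h : S ⊆ T) : U S ≤ U T := fun _ hx v hv => hx v (fun h' => hv (h h'))

lemma card_tors (G : Subgroup Kˣ) (h : (-1 : Kˣ) ∈ G) :
    Nat.card (powMonoidHom 2 : G →* G).ker = 2 := by
  rw [Nat.card_eq_two_iff]
  refine ⟨1, ⟨⟨-1, h⟩, by ext; simp⟩, ?_, ?_⟩
  · intro h
    have := congrArg (fun x : (powMonoidHom 2 : G →* G).ker => (((x : G) : Kˣ) : K)) h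
    simp only [OneMemClass.coe_one, Units.val_one, Units.val_neg] at this
    have h2 : (2 : K) = 0 := by linear_combination this
    norm_num at h2
  · ext x
    simp only [Set.mem_insert_iff, Set.mem_singleton_iff, Set.mem_univ, iff_true]
    have h1 : ((x : G) : Kˣ) ^ 2 = 1 := by
      have := MonoidHom.mem_ker.1 x.2
      exact congrArg Subtype.val this
    have h2 : (((x : G) : Kˣ) : K) ^ 2 = 1 := by
      rw [← Units.val_pow_eq_pow_val, h1, Units.val_one]
    rcases (mul_self_eq_one_iff.1 ((sq _).symm.trans h2)) with h | h
    · left; ext; simpa using h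
    · right; ext; simpa using h

lemma val_of_span {v : Pl K} {r : 𝓞 K} {n : ℕ} {I : Ideal (𝓞 K)} (h : Ideal.span {r} = v.asIdeal ^ n * I)
    (hI : ¬ v.asIdeal ∣ I) : v.valuation K (r : K) = exp (-(n : ℤ)) := by
  have h1 : r ∈ v.asIdeal ^ n := by
    rw [← Ideal.dvd_span_singleton, h]; exact dvd_mul_right _ _
  have h2 : r ∉ v.asIdeal ^ (n + 1) := by
    rw [← Ideal.dvd_span_singleton, h, pow_succ]
    intro hd
    exact hI ((mul_dvd_mul_iff_left (pow_ne_zero n v.ne_bot)).1 hd)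
  rw [mem_pow_iff] at h1 h2
  refine le_antisymm h1 (not_lt.1 fun h3 => h2 ?_)
  have := le_exp_pred h3
  refine this.trans (le_of_eq ?_)
  congr 1; push_cast; ring

lemma not_dvd_of_ne {v w : Pl K} (h : v ≠ w) (n : ℕ) : ¬ v.asIdeal ∣ w.asIdeal ^ n := by
  intro hd
  have := v.prime.dvd_of_dvd_pow hd
  have h2 := Ideal.dvd_iff_le.1 this
  exact h (HeightOneSpectrum.ext (w.isMaximal.eq_of_le v.isPrime.ne_top h2).symm)

lemma val_one_of_span {v : Pl K} {r : 𝓞 K} (h : ¬ v.asIdeal ∣ Ideal.span {r}) :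
    v.valuation K (r : K) = 1 := by
  have := val_of_span (v := v) (r := r) (n := 0) (I := Ideal.span {r}) (by simp) h
  simpa using this

/-- elements supported at one prime -/
lemma exists_supp (v : Pl K) : ∃ (h : ℕ) (x : Kˣ), h ≠ 0 ∧ v.valuation K (x : K) = exp (-(h : ℤ)) ∧
    ∀ w ≠ v, w.valuation K (x : K) = 1 := by
  set h := Fintype.card (ClassGroup (𝓞 K)) with hh
  have hv0 : v.asIdeal ∈ nonZeroDivisors (Ideal (𝓞 K)) := mem_nonZeroDivisors_iff_ne_zero.2 v.ne_bot
  have h1 : ClassGroup.mk0 (⟨v.asIdeal, hv0⟩ ^ h) = (1 : ClassGroup (𝓞 K)) := by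
    rw [map_pow, pow_card_eq_one]
  rw [ClassGroup.mk0_eq_one_iff] at h1
  obtain ⟨r, hr⟩ := h1.principal
  have hr' : Ideal.span {r} = v.asIdeal ^ h * 1 := by
    rw [mul_one]; exact hr.symm
  have hvr := val_of_span hr' (by
    rw [← isUnit_iff_dvd_one]; exact v.prime.not_isUnit)
  have hr0 : (r : K) ≠ 0 := by
    intro h; rw [h] at hvr; simp at hvr; exact exp_ne_zero hvr.symm
  refine ⟨h, Units.mk0 _ hr0, Fintype.card_ne_zero, hvr, fun w hw => ?_⟩
  apply val_one_of_span
  rw [hr', mul_one]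
  exact not_dvd_of_ne hw _

/-- class group trivialised -/
structure Good (S : Finset (Pl K)) : Prop where
  odd : ∀ v ∉ S, v.valuation K 2 = 1
  unif : ∀ v ∉ S, ∃ π : Kˣ, v.valuation K (π : K) = exp (-1 : ℤ) ∧ ∀ w ∉ S, w ≠ v → w.valuation K (π : K) = 1

lemma Good.mono {S T : Finset (Pl K)} (hS : Good S) (h : S ⊆ T) : Good T :=
  ⟨fun v hv => hS.odd v (fun h' => hv (h h')), fun v hv => by
    obtain ⟨π, h1, h2⟩ := hS.unif v (fun h' => hv (h h'))
    exact ⟨π, h1, fun w hw => h2 w (fun h' => hw (h h'))⟩⟩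

lemma finite_dvd (I : Ideal (𝓞 K)) (hI : I ≠ 0) : {v : Pl K | v.asIdeal ∣ I}.Finite :=
  Ideal.finite_factors hI

/-- places where an element is not a unit -/
lemma finite_val (x : Kˣ) : {v : Pl K | v.valuation K (x : K) ≠ 1}.Finite := by
  obtain ⟨a, b, hb, hab⟩ := IsFractionRing.div_surjective (A := 𝓞 K) (x : K)
  have hb0 : b ≠ 0 := nonZeroDivisors.ne_zero hb
  have ha0 : a ≠ 0 := by
    rintro rfl
    simp at hab
    exact x.ne_zero hab.symm
  refine ((finite_dvd (Ideal.span {a}) (by simpa using ha0)).union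
    (finite_dvd (Ideal.span {b}) (by simpa using hb0))).subset ?_
  intro v hv
  by_contra h
  simp only [Set.mem_union, Set.mem_ofPred_eq, not_or] at h
  apply hv
  have h1 : v.valuation K (algebraMap (𝓞 K) K a) = 1 := val_one_of_span h.1
  have h2 : v.valuation K (algebraMap (𝓞 K) K b) = 1 := val_one_of_span h.2
  rw [← hab, map_div₀, h1, h2, div_one]

lemma exists_good (S : Finset (Pl K)) : ∃ T, S ⊆ T ∧ Good T := by
  classical
  choose I hI using ClassGroup.mk0_surjective (R := 𝓞 K)
  have hf : ∀ c, {v : Pl K | v.asIdeal ∣ (I c : Ideal (𝓞 K))}.Finite := fun c =>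
    finite_dvd _ (nonZeroDivisors.ne_zero (I c).2)
  refine ⟨S ∪ (finite_val (K := K) (Units.mk0 2 two_ne_zero)).toFinset ∪
    Finset.univ.biUnion (fun c => (hf c).toFinset), ?_, ?_, ?_⟩
  · intro v hv; simp [hv]
  · intro v hv
    by_contra h
    apply hv
    simp [h]
  · intro v hv
    have hv0 : v.asIdeal ∈ nonZeroDivisors (Ideal (𝓞 K)) := mem_nonZeroDivisors_iff_ne_zero.2 v.ne_bot
    set c := (ClassGroup.mk0 ⟨v.asIdeal, hv0⟩)⁻¹ with hc
    have hno : ∀ w, w ∉ S ∪ (finite_val (K := K) (Units.mk0 2 two_ne_zero)).toFinset ∪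
        Finset.univ.biUnion (fun c => (hf c).toFinset) → ¬ w.asIdeal ∣ (I c : Ideal (𝓞 K)) := by
      intro w hw hd
      apply hw
      simp only [Finset.mem_union, Finset.mem_biUnion, Finset.mem_univ, true_and, Set.Finite.mem_toFinset]
      exact Or.inr ⟨c, hd⟩
    have h1 : ClassGroup.mk0 (⟨v.asIdeal, hv0⟩ * I c) = (1 : ClassGroup (𝓞 K)) := by
      rw [map_mul, hI, hc, mul_inv_cancel]
    rw [ClassGroup.mk0_eq_one_iff] at h1
    obtain ⟨r, hr⟩ := h1.principal
    have hr' : Ideal.span {r} = v.asIdeal ^ 1 * (I c : Ideal (𝓞 K)) := by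
      rw [pow_one]; exact hr.symm
    have hvr := val_of_span hr' (hno v hv)
    have hr0 : (r : K) ≠ 0 := by
      intro h; rw [h] at hvr; simp at hvr; exact exp_ne_zero hvr.symm
    refine ⟨Units.mk0 _ hr0, by simpa using hvr, fun w hw hwv => ?_⟩
    apply val_one_of_span
    rw [hr']
    intro hd
    rcases w.prime.dvd_or_dvd hd with h | h
    · exact not_dvd_of_ne hwv _ h
    · exact hno w hw h

end CQ

namespace CQ
open IsDedekindDomain NumberField WithZero
universe u
set_option linter.unusedSectionVars false
set_option linter.unusedSimpArgs false
set_option linter.unusedVariables false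
set_option linter.style.haveILetI false
variable {K : Type u} [Field K] [NumberField K]

lemma exists_oUnit {x : Kˣ} (hx : ∀ v : Pl K, v.valuation K (x : K) = 1) :
    ∃ r : (𝓞 K)ˣ, Units.map (algebraMap (𝓞 K) K : 𝓞 K →* K) r = x := by
  obtain ⟨r, hr⟩ := HeightOneSpectrum.mem_integers_of_valuation_le_one (R := 𝓞 K) K (x : K) (fun v => (hx v).le)
  obtain ⟨s, hs⟩ := HeightOneSpectrum.mem_integers_of_valuation_le_one (R := 𝓞 K) K ((x⁻¹ : Kˣ) : K)
    (fun v => by push_cast; rw [map_inv₀, hx v, inv_one])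
  have hrs : r * s = 1 := by
    apply IsFractionRing.injective (𝓞 K) K
    rw [map_mul, hr, hs, map_one]; simp
  refine ⟨⟨r, s, hrs, by rw [mul_comm, hrs]⟩, ?_⟩
  ext
  exact hr

lemma oUnit_val (r : (𝓞 K)ˣ) (v : Pl K) :
    v.valuation K ((Units.map (algebraMap (𝓞 K) K : 𝓞 K →* K) r : Kˣ) : K) = 1 := by
  have h1 : v.valuation K (algebraMap (𝓞 K) K (r : 𝓞 K)) ≤ 1 := v.valuation_le_one _
  have h2 : v.valuation K (algebraMap (𝓞 K) K ((r⁻¹ : (𝓞 K)ˣ) : 𝓞 K)) ≤ 1 := v.valuation_le_one _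
  refine le_antisymm h1 ?_
  have h3 : v.valuation K (algebraMap (𝓞 K) K (r : 𝓞 K)) * v.valuation K (algebraMap (𝓞 K) K ((r⁻¹ : (𝓞 K)ˣ) : 𝓞 K)) = 1 := by
    rw [← map_mul, ← map_mul, Units.mul_inv, map_one, map_one]
  calc (1 : ℤᵐ⁰) = _ := h3.symm
    _ ≤ _ := mul_le_of_le_one_right' h2

/-- valuation map -/
noncomputable def phi (S : Finset (Pl K)) : Additive (U S) →ₗ[ℤ] (S → ℤ) :=
  AddMonoidHom.toIntLinearMap
  { toFun := fun x v => log ((v : Pl K).valuation K (((Additive.toMul x : U S) : Kˣ) : K))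
    map_zero' := by ext v; simp
    map_add' := by
      intro x y
      ext v
      simp only [toMul_add, Subgroup.coe_mul, Units.val_mul, map_mul, Pi.add_apply]
      rw [log_mul (by simp) (by simp)] }

lemma phi_apply (S : Finset (Pl K)) (x : U S) (v : S) :
    phi S (Additive.ofMul x) v = log ((v : Pl K).valuation K ((x : Kˣ) : K)) := rfl

noncomputable def psi (S : Finset (Pl K)) : Additive (𝓞 K)ˣ →ₗ[ℤ] Additive (U S) :=
  AddMonoidHom.toIntLinearMap (MonoidHom.toAdditive
    ((Units.map (algebraMap (𝓞 K) K : 𝓞 K →* K)).codRestrict (U S) (fun r v _ => oUnit_val r v)))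

lemma psi_inj (S : Finset (Pl K)) : Function.Injective (psi S) := by
  intro x y h
  have h1 := congrArg (fun z : Additive (U S) => (((Additive.toMul z : U S) : Kˣ) : K)) h
  have h2 : algebraMap (𝓞 K) K (Additive.toMul x : (𝓞 K)ˣ) = algebraMap (𝓞 K) K (Additive.toMul y : (𝓞 K)ˣ) := h1
  have h3 := IsFractionRing.injective (𝓞 K) K h2
  exact Units.ext h3

lemma psi_range (S : Finset (Pl K)) : LinearMap.range (psi S) = LinearMap.ker (phi S) := by
  ext x
  induction x with | ofMul x
  rw [LinearMap.mem_ker]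
  constructor
  · rintro ⟨r, hr⟩
    rw [← hr]
    ext v
    have : ((Additive.toMul (psi S r) : U S) : Kˣ) = Units.map (algebraMap (𝓞 K) K : 𝓞 K →* K) (Additive.toMul r) := rfl
    show log ((v : Pl K).valuation K (((Additive.toMul (psi S r) : U S) : Kˣ) : K)) = 0
    rw [this, oUnit_val, log_one]
  · intro h
    obtain ⟨r, hr⟩ := exists_oUnit (x := (x : Kˣ)) (fun v => by
      by_cases hv : v ∈ S
      · have := congrFun h ⟨v, hv⟩
        rw [phi_apply] at this
        have h0 : v.valuation K ((x : Kˣ) : K) ≠ 0 := by simp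
        simp only at this
        rw [← exp_log h0, this]; simp
      · exact x.2 v hv)
    exact ⟨Additive.ofMul r, congrArg Additive.ofMul (Subtype.ext hr)⟩

instance U_finite (S : Finset (Pl K)) : Module.Finite ℤ (Additive (U S)) := by
  haveI : Module.Finite ℤ (LinearMap.ker (phi S)) := by
    rw [← psi_range]; infer_instance
  haveI : Module.Finite ℤ (Additive (U S) ⧸ LinearMap.ker (phi S)) :=
    Module.Finite.equiv (phi S).quotKerEquivRange.symm
  exact Module.Finite.of_submodule_quotient (LinearMap.ker (phi S))

/-- rank plus one of S-units -/
noncomputable def sK (S : Finset (Pl K)) : ℕ := S.card + Fintype.card (InfinitePlace K)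

lemma sK_pos (S : Finset (Pl K)) : 0 < sK S := by
  have : 0 < Fintype.card (InfinitePlace K) := Fintype.card_pos
  unfold sK; omega

lemma U_rank (S : Finset (Pl K)) : Module.finrank ℤ (Additive (U S)) + 1 = sK S := by
  classical
  have h1 := (LinearMap.ker (phi S)).finrank_quotient_add_finrank
  rw [(phi S).quotKerEquivRange.finrank_eq, ← psi_range,
    LinearMap.finrank_range_of_inj (psi_inj S), Units.finrank_eq] at h1
  have h2 := (LinearMap.range (phi S)).finrank_quotient_add_finrank
  have h3 : Module.finrank ℤ ((S → ℤ) ⧸ LinearMap.range (phi S)) = 0 := by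
    apply Module.IsTorsion.finrank_eq_zero
    choose h x hh hx1 hx2 using fun v : Pl K => exists_supp v
    have hxU : ∀ v : S, x v ∈ U S := fun v w hw => hx2 v w (fun h => hw (h ▸ v.2))
    have hphi : ∀ v : S, phi S (Additive.ofMul ⟨x v, hxU v⟩) = Pi.single v (-(h v : ℤ)) := by
      intro v
      ext w
      rw [phi_apply]
      by_cases hwv : w = v
      · subst hwv
        simp [hx1]
      · rw [Pi.single_eq_of_ne hwv]
        simp only
        rw [hx2 v w (fun h => hwv (Subtype.ext h)), log_one]
    intro y
    obtain ⟨y, rfl⟩ := Submodule.mkQ_surjective _ y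
    refine ⟨⟨∏ v : S, (h v : ℤ), mem_nonZeroDivisors_of_ne_zero
      (Finset.prod_ne_zero_iff.2 fun v _ => by exact_mod_cast hh v)⟩, ?_⟩
    rw [Submonoid.mk_smul, ← map_smul, ← LinearMap.mem_ker, Submodule.ker_mkQ]
    have : (∏ v : S, (h v : ℤ)) • y = ∑ v : S, (-(∏ w ∈ Finset.univ.erase v, (h w : ℤ)) * y v) •
        (Pi.single v (-(h v : ℤ)) : S → ℤ) := by
      ext w
      simp only [Pi.smul_apply, smul_eq_mul, Finset.sum_apply, Pi.single_apply]
      simp only [mul_ite, mul_zero, Finset.sum_ite_eq, Finset.mem_univ, if_true]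
      rw [← Finset.mul_prod_erase _ _ (Finset.mem_univ w)]
      ring
    rw [this]
    refine Submodule.sum_mem _ fun v _ => Submodule.smul_mem _ _ ?_
    exact ⟨_, hphi v⟩
  rw [h3, zero_add] at h2
  have h4 : Module.finrank ℤ (S → ℤ) = S.card := by simp
  have h5 : 0 < Fintype.card (InfinitePlace K) := Fintype.card_pos
  rw [h2, h4, Units.rank] at h1
  unfold sK
  omega

lemma neg_one_mem_U (S : Finset (Pl K)) : (-1 : Kˣ) ∈ U S := fun v _ => by simp [Valuation.map_neg]

lemma U_index (S : Finset (Pl K)) : (powMonoidHom 2 : U S →* U S).range.index = 2 ^ sK S := by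
  rw [index_mul, card_tors _ (neg_one_mem_U S), ← pow_succ, U_rank]

end CQ

namespace CQ
open IsDedekindDomain NumberField WithZero
universe u
set_option linter.unusedSectionVars false
set_option linter.unusedSimpArgs false
set_option linter.unusedVariables false
set_option linter.style.haveILetI false
variable {K : Type u} [Field K] [NumberField K]

/-- quadratic extension data -/
structure Quad (K L : Type u) [Field K] [Field L] [Algebra K L] (a : Kˣ) where
  σ : L ≃ₐ[K] L
  r : Lˣ
  hr : (r : L) ^ 2 = algebraMap K L a
  hσ : σ (r : L) = - r
  gen : ∀ x : L, ∃ α β : K, x = algebraMap K L α + algebraMap K L β * r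
  ns : a ∉ GSq K
  fr : Module.finrank K L = 2

lemma exists_quad (a : Kˣ) (ha : a ∉ GSq K) :
    ∃ (L : Type u) (_ : Field L) (_ : NumberField L) (_ : Algebra K L),
      Nonempty (Quad K L a) := by
  have hf : ∀ r : K, r ^ 2 ≠ (a : K) + 0 * r := by
    intro r hr
    have hr0 : r ≠ 0 := by
      rintro rfl
      exact a.ne_zero (by simpa using hr.symm)
    exact ha ⟨Units.mk0 r hr0, by ext; simpa using hr⟩
  haveI : Fact (∀ r : K, r ^ 2 ≠ (a : K) + 0 * r) := ⟨hf⟩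
  letI : Field (QuadraticAlgebra K (a : K) 0) := inferInstance
  haveI : CharZero (QuadraticAlgebra K (a : K) 0) := charZero_of_injective_algebraMap
    (algebraMap K (QuadraticAlgebra K (a : K) 0)).injective
  haveI : NumberField (QuadraticAlgebra K (a : K) 0) :=
    { to_charZero := inferInstance
      to_finiteDimensional := Module.Finite.trans K _ }
  refine ⟨QuadraticAlgebra K (a : K) 0, inferInstance, inferInstance, inferInstance, ⟨?_⟩⟩
  have hom : (QuadraticAlgebra.omega : QuadraticAlgebra K (a : K) 0) ≠ 0 := by
    intro h
    have := congrArg QuadraticAlgebra.im h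
    simp at this
  refine ⟨AlgEquiv.ofRingEquiv (f := starRingAut) ?_, Units.mk0 _ hom, ?_, ?_, ?_, ha, QuadraticAlgebra.finrank_eq_two _ _⟩
  · intro x; ext <;> simp
  · rw [Units.val_mk0, pow_two, QuadraticAlgebra.omega_mul_omega_eq_algebraMap]; simp
  · ext <;> simp
  · rintro ⟨x, y⟩
    refine ⟨x, y, ?_⟩
    ext <;> simp

section
variable {L : Type u} [Field L] [NumberField L] [Algebra K L]

lemma exists_ram (K) [Field K] [NumberField K] [Algebra K L] (w : Pl L) : ∃ e : ℕ, e ≠ 0 ∧ ∀ x : K,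
    w.valuation L (algebraMap K L x) = (w.under (𝓞 K)).valuation K x ^ e := by
  haveI : w.asIdeal.LiesOver (w.under (𝓞 K)).asIdeal := ⟨rfl⟩
  exact ⟨_, Ideal.IsDedekindDomain.ramificationIdx'_ne_zero_of_liesOver w.asIdeal (w.under (𝓞 K)).ne_bot,
    fun x => (HeightOneSpectrum.valuation_liesOver L (w.under (𝓞 K)) w x).symm⟩

lemma exists_above (L : Type u) [Field L] [NumberField L] [Algebra K L] (v : Pl K) : ∃ w : Pl L, w.under (𝓞 K) = v := by
  obtain ⟨P, hP, hP'⟩ := Ideal.exists_maximal_ideal_liesOver_of_isIntegral v.asIdeal (S := 𝓞 L)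
  refine ⟨⟨P, hP.isPrime, ?_⟩, ?_⟩
  · rintro rfl
    apply v.ne_bot
    rw [hP'.over]
    exact Ideal.under_bot (𝓞 K) (𝓞 L)
  · ext1
    exact hP'.over.symm

lemma finite_above (L : Type u) [Field L] [NumberField L] [Algebra K L] (v : Pl K) : {w : Pl L | w.under (𝓞 K) = v}.Finite := by
  have := IsDedekindDomain.primesOver_finite v.asIdeal (𝓞 L)
  refine Set.Finite.of_finite_image (f := HeightOneSpectrum.asIdeal) (this.subset ?_) ?_
  · rintro _ ⟨w, rfl, rfl⟩
    exact ⟨w.isPrime, ⟨rfl⟩⟩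
  · intro x _ y _ h
    exact HeightOneSpectrum.ext h

lemma over_lt {w : Pl L} {x y : K} : w.valuation L (algebraMap K L x) < w.valuation L (algebraMap K L y) ↔
    (w.under (𝓞 K)).valuation K x < (w.under (𝓞 K)).valuation K y := by
  obtain ⟨e, he, h⟩ := exists_ram K w
  rw [h, h]
  exact pow_lt_pow_iff_left₀ zero_le zero_le he

lemma over_le {w : Pl L} {x y : K} : w.valuation L (algebraMap K L x) ≤ w.valuation L (algebraMap K L y) ↔
    (w.under (𝓞 K)).valuation K x ≤ (w.under (𝓞 K)).valuation K y := by
  rw [← not_lt, over_lt, not_lt]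

lemma over_eq {w : Pl L} {x y : K} : w.valuation L (algebraMap K L x) = w.valuation L (algebraMap K L y) ↔
    (w.under (𝓞 K)).valuation K x = (w.under (𝓞 K)).valuation K y := by
  rw [le_antisymm_iff, le_antisymm_iff, over_le, over_le]

lemma over_one {w : Pl L} {x : K} : w.valuation L (algebraMap K L x) = 1 ↔
    (w.under (𝓞 K)).valuation K x = 1 := by
  simpa using over_eq (w := w) (x := x) (y := 1)

/-- inclusion of unit groups -/
noncomputable abbrev inc (K L : Type u) [Field K] [Field L] [Algebra K L] : Kˣ →* Lˣ := Units.map (algebraMap K L : K →* L)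

lemma inc_W {w : Pl L} {x : Kˣ} (hx : x ∈ W (w.under (𝓞 K))) : inc K L x ∈ W w := by
  rw [mem_W] at *
  have := (over_lt (w := w) (x := (x : K) - 1) (y := 4)).2 hx
  rw [map_sub, map_one, map_ofNat] at this
  exact this

lemma inc_Sq {w : Pl L} {x : Kˣ} (hx : x ∈ Sq (w.under (𝓞 K))) : inc K L x ∈ Sq w := by
  obtain ⟨z, w', hw, rfl⟩ := mem_Sq.1 hx
  exact mem_Sq.2 ⟨inc K L z, _, inc_W hw, by simp⟩

lemma inc_Ng {w : Pl L} {a : K} {x : Kˣ} (hx : x ∈ Ng (w.under (𝓞 K)) a) : inc K L x ∈ Ng w (algebraMap K L a) := by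
  obtain ⟨n, ⟨s, t, hn⟩, w', hw, rfl⟩ := mem_Ng.1 hx
  refine mem_Ng.2 ⟨inc K L n, ⟨algebraMap K L s, algebraMap K L t, ?_⟩, _, inc_W hw, by simp⟩
  simp [hn]

/-- conjugate place -/
noncomputable def conj (σ : L ≃ₐ[K] L) (w : Pl L) : Pl L :=
  HeightOneSpectrum.comap (RingOfIntegers.mapRingEquiv (σ : L ≃+* L)).toRingHom (RingOfIntegers.mapRingEquiv (σ : L ≃+* L)).surjective w

lemma conj_val (σ : L ≃ₐ[K] L) (w : Pl L) (x : L) : (conj σ w).valuation L x = w.valuation L (σ x) := by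
  set f := RingOfIntegers.mapRingEquiv (σ : L ≃+* L) with hf
  have hfc : ∀ r : 𝓞 L, ((f r : 𝓞 L) : L) = σ (r : L) := fun r => rfl
  have key : ∀ (n : ℕ) (r : 𝓞 L), r ∈ (conj σ w).asIdeal ^ n ↔ f r ∈ w.asIdeal ^ n := by
    intro n r
    have h1 : (conj σ w).asIdeal = Ideal.map (f.symm : 𝓞 L →+* 𝓞 L) w.asIdeal := by
      exact (Ideal.map_symm (I := w.asIdeal) f).symm
    rw [h1, ← Ideal.map_pow]
    have h2 : Ideal.map (f.symm : 𝓞 L →+* 𝓞 L) (w.asIdeal ^ n) = Ideal.comap (f : 𝓞 L →+* 𝓞 L) (w.asIdeal ^ n) := 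
      Ideal.map_symm (I := w.asIdeal ^ n) f
    rw [h2]; rfl
  have hint : ∀ r : 𝓞 L, (conj σ w).valuation L (r : L) = w.valuation L (σ (r : L)) := by
    intro r
    by_cases hr : r = 0
    · simp [hr]
    have aux : ∀ (u : Pl L) (s : 𝓞 L), s ≠ 0 → ∃ m : ℕ, u.valuation L (s : L) = exp (-(m : ℤ)) := by
      intro u s hs
      have h1 : u.valuation L (s : L) ≠ 0 := by simpa using hs
      have h2 : u.valuation L (s : L) ≤ 1 := u.valuation_le_one s
      refine ⟨(-log (u.valuation L (s : L))).toNat, ?_⟩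
      rw [← exp_log h1, ← exp_zero, exp_le_exp] at h2
      rw [Int.toNat_of_nonneg (by omega), neg_neg, exp_log h1]
    obtain ⟨m, hm⟩ := aux (conj σ w) r hr
    obtain ⟨m', hm'⟩ := aux w (f r) (by simpa using hr)
    rw [hfc] at hm'
    apply le_antisymm
    · rw [hm']
      rw [← mem_pow_iff, key, mem_pow_iff, hfc, hm']
    · rw [hm, ← hfc, ← mem_pow_iff, ← key, mem_pow_iff, hm]
  obtain ⟨p, q, hq, rfl⟩ := IsFractionRing.div_surjective (A := 𝓞 L) x
  have h1 := hint p
  have h2 := hint q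
  rw [map_div₀, map_div₀, map_div₀]
  exact congrArg₂ (· / ·) h1 h2

lemma conj_under (σ : L ≃ₐ[K] L) (w : Pl L) : (conj σ w).under (𝓞 K) = w.under (𝓞 K) := by
  ext x
  have h1 := conj_val σ w (algebraMap K L (x : K))
  rw [AlgEquiv.commutes] at h1
  have h2 := over_lt (K := K) (w := w) (x := x) (y := 1)
  have h3 := over_lt (K := K) (w := conj σ w) (x := x) (y := 1)
  rw [h1, map_one, map_one] at h3
  rw [map_one, map_one] at h2
  have h4 : ∀ v : Pl K, v.valuation K (x : K) < 1 ↔ x ∈ v.asIdeal := fun v => v.valuation_lt_one_iff_mem x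
  rw [map_one] at h2 h3
  rw [← h4, ← h4, ← h2, ← h3]
end
end CQ

namespace CQ
open IsDedekindDomain NumberField WithZero
universe u
set_option linter.unusedSectionVars false
set_option linter.unusedSimpArgs false
set_option linter.unusedVariables false
set_option linter.style.haveILetI false
variable {K : Type u} [Field K] [NumberField K]

lemma card_tors' {A : Type*} [CommGroup A] (f : A →* Kˣ) (hf : Function.Injective f) (x : A) (h : f x = -1) :
    Nat.card (powMonoidHom 2 : A →* A).ker = 2 := by
  rw [Nat.card_eq_two_iff]
  refine ⟨1, ⟨x, ?_⟩, ?_, ?_⟩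
  · rw [MonoidHom.mem_ker]; apply hf; simp [h]
  · intro h'
    have h2 := congrArg (fun z : (powMonoidHom 2 : A →* A).ker => ((f z : Kˣ) : K)) h'
    simp [h] at h2
    have h3 : (2 : K) = 0 := by linear_combination h2
    exact two_ne_zero h3
  · ext y
    have hy := y.2
    rw [MonoidHom.mem_ker] at hy
    have h2 := congrArg (fun z => ((f z : Kˣ) : K)) hy
    simp at h2
    simp only [Set.mem_insert_iff, Set.mem_singleton_iff, Set.mem_univ, iff_true]
    rcases h2 with h2 | h2
    · left; apply Subtype.ext; apply hf; ext; simpa using h2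
    · right; apply Subtype.ext; apply hf; ext; simpa [h] using h2

lemma sq_relIndex {A : Type*} [CommGroup A] (F : Subgroup A) :
    (F.map (powMonoidHom 2)).relIndex F = (powMonoidHom 2 : F →* F).range.index := by
  rw [Subgroup.relIndex]
  congr 1
  ext x
  rw [Subgroup.mem_subgroupOf, Subgroup.mem_map, MonoidHom.mem_range]
  constructor
  · rintro ⟨y, hy, h⟩
    exact ⟨⟨y, hy⟩, Subtype.ext h⟩
  · rintro ⟨y, h⟩
    exact ⟨y, y.2, congrArg Subtype.val h⟩

lemma herbrand {A : Type*} [CommGroup A] [Module.Finite ℤ (Additive A)] (N D : A →* A)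
    (h1 : ∀ x ∈ D.ker, N x = x ^ 2) (h2 : ∀ x ∈ N.ker, D x = x ^ 2) (h3 : N.ker = D.range)
    (h4 : ∀ x, N x ∈ D.ker)
    (h5 : Nat.card (powMonoidHom 2 : D.ker →* D.ker).ker = 2)
    (h6 : Nat.card (powMonoidHom 2 : N.ker →* N.ker).ker = 2) :
    N.range.relIndex D.ker * 2 ^ Module.finrank ℤ (Additive A) =
      4 ^ Module.finrank ℤ (Additive D.ker) := by
  have hc : (D.ker.map (powMonoidHom 2)).comap N = (N.ker.map (powMonoidHom 2)).comap D := by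
    ext x
    simp only [Subgroup.mem_comap, Subgroup.mem_map, powMonoidHom_apply]
    constructor
    · rintro ⟨f, hf, h⟩
      have hx : x / f ∈ N.ker := by rw [MonoidHom.mem_ker, map_div, ← h, h1 f hf, div_self']
      refine ⟨x / f, hx, ?_⟩
      rw [← h2 _ hx, map_div, MonoidHom.mem_ker.1 hf, div_one]
    · rintro ⟨f, hf, h⟩
      have hx : x / f ∈ D.ker := by rw [MonoidHom.mem_ker, map_div, ← h, h2 f hf, div_self']
      refine ⟨x / f, hx, ?_⟩
      rw [← h1 _ hx, map_div, MonoidHom.mem_ker.1 hf, div_one]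
  have e1 := congrArg Subgroup.index hc
  rw [Subgroup.index_comap, Subgroup.index_comap, ← h3, sq_relIndex] at e1
  have le1 : D.ker.map (powMonoidHom 2) ≤ N.range := by
    rintro _ ⟨x, hx, rfl⟩
    exact ⟨x, h1 x hx⟩
  have le2 : N.range ≤ D.ker := by rintro _ ⟨x, rfl⟩; exact h4 x
  have e2 := Subgroup.relIndex_mul_relIndex _ _ _ le1 le2
  rw [e1, sq_relIndex] at e2
  have fin : ∀ H : Subgroup A, Module.Finite ℤ (Additive H) := by
    intro H
    have : Module.Finite ℤ (AddSubgroup.toIntSubmodule (Subgroup.toAddSubgroup H)) := inferInstance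
    exact this
  haveI := fin D.ker
  haveI := fin N.ker
  rw [index_mul, index_mul, h5, h6] at e2
  have e3 : Module.finrank ℤ (Additive A) = Module.finrank ℤ (Additive N.ker) + Module.finrank ℤ (Additive D.ker) := by
    set D' : Additive A →ₗ[ℤ] Additive A := D.toAdditive.toIntLinearMap with hD'
    have q := (LinearMap.ker D').finrank_quotient_add_finrank
    rw [D'.quotKerEquivRange.finrank_eq] at q
    rw [← q, h3]
    rfl
  rw [e3, pow_add]
  have : (4 : ℕ) = 2 * 2 := rfl
  rw [this, mul_pow]
  have e4 : 2 ^ Module.finrank ℤ (Additive N.ker) * N.range.relIndex D.ker = 2 ^ Module.finrank ℤ (Additive D.ker) := by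
    apply Nat.eq_of_mul_eq_mul_right (show 0 < 2 by norm_num)
    rw [← e2]; ring
  rw [← e4]; ring

lemma good_elt {S : Finset (Pl K)} (hS : Good S) (m : Pl K → ℤ) (hm : {v | v ∉ S ∧ m v ≠ 0}.Finite) :
    ∃ c : Kˣ, ∀ v ∉ S, v.valuation K (c : K) = exp (m v) := by
  classical
  choose! π h1 h2 using hS.unif
  refine ⟨∏ v ∈ hm.toFinset, (π v) ^ (-m v), fun v hv => ?_⟩
  rw [Units.coe_prod, map_prod, Finset.prod_eq_single v]
  · push_cast
    rw [map_zpow₀, h1 v hv, ← exp_zsmul]; simp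
  · intro u hu huv
    have hu' : u ∉ S := by simpa using (hm.mem_toFinset.1 hu).1
    push_cast
    rw [map_zpow₀, h2 u hu' v hv huv.symm, one_zpow]
  · intro h
    have h0 : m v = 0 := by
      by_contra h'
      exact h (hm.mem_toFinset.2 ⟨hv, h'⟩)
    simp [h0]
end CQ

namespace CQ
open IsDedekindDomain NumberField WithZero
universe u
set_option linter.unusedSectionVars false
set_option linter.unusedSimpArgs false
set_option linter.unusedVariables false
set_option linter.style.haveILetI false
variable {K : Type u} [Field K] [NumberField K]

section
variable {L : Type u} [Field L] [NumberField L] [Algebra K L]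

lemma Quad.invol {a : Kˣ} (q : Quad K L a) (x : L) : q.σ (q.σ x) = x := by
  obtain ⟨α, β, rfl⟩ := q.gen x
  simp [q.hσ]

lemma Quad.fixed {a : Kˣ} (q : Quad K L a) {x : L} (h : q.σ x = x) : ∃ α : K, algebraMap K L α = x := by
  obtain ⟨α, β, rfl⟩ := q.gen x
  simp only [map_add, map_mul, AlgEquiv.commutes, q.hσ] at h
  have hr : (q.r : L) ≠ 0 := q.r.ne_zero
  have h2 : (2 : L) * (algebraMap K L β * q.r) = 0 := by linear_combination -h
  have h3 : algebraMap K L β * q.r = 0 := by simpa using h2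
  exact ⟨α, by rw [h3, add_zero]⟩

lemma Quad.h90 {a : Kˣ} (q : Quad K L a) {x : L} (h : x * q.σ x = 1) : ∃ y : Lˣ, x * q.σ y = y := by
  by_cases hx : 1 + x = 0
  · refine ⟨q.r, ?_⟩
    rw [q.hσ]
    linear_combination (-(q.r : L)) * hx
  · refine ⟨Units.mk0 _ hx, ?_⟩
    simp only [Units.val_mk0, map_add, map_one]
    linear_combination h

/-- primes above a finite set -/
noncomputable def above (L : Type u) [Field L] [NumberField L] [Algebra K L] (S : Finset (Pl K)) : Finset (Pl L) :=
  (Set.Finite.biUnion S.finite_toSet (fun v _ => finite_above L v)).toFinset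

lemma mem_above {S : Finset (Pl K)} {w : Pl L} : w ∈ above L S ↔ w.under (𝓞 K) ∈ S := by
  simp [above]

lemma Quad.match {a : Kˣ} (q : Quad K L a) {S : Finset (Pl K)} (hS : Good S) (ha : a ∈ U S) (y : Lˣ)
    (hy : ∀ w ∉ above L S, w.valuation L (q.σ y) = w.valuation L (y : L)) :
    ∃ c : Kˣ, ∀ w ∉ above L S, w.valuation L (algebraMap K L c) = w.valuation L (y : L) := by
  classical
  obtain ⟨α, β, hαβ⟩ := q.gen y
  have key : ∀ v : Pl K, ∃ γ : Kˣ, v ∉ S → ∀ w : Pl L, w.under (𝓞 K) = v → w.valuation L (algebraMap K L γ) = w.valuation L (y : L) := by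
    intro v
    by_cases hv : v ∈ S
    · exact ⟨1, fun h => absurd hv h⟩
    have main : ∀ w : Pl L, w.under (𝓞 K) = v → w.valuation L (y : L) = max (w.valuation L (algebraMap K L α)) (w.valuation L (algebraMap K L β)) := by
      intro w hw
      have hw' : w ∉ above L S := by rw [mem_above, hw]; exact hv
      have h2 : w.valuation L (2 : L) = 1 := by
        have := (over_one (w := w) (x := (2 : K))).2 (by rw [hw]; exact hS.odd v hv)
        rwa [map_ofNat] at this
      have hr : w.valuation L (q.r : L) = 1 := by
        have h3 := (over_one (w := w) (x := (a : K))).2 (by rw [hw]; exact ha v hv)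
        rw [← q.hr, map_pow] at h3
        exact (pow_eq_one_iff_of_nonneg zero_le two_ne_zero).1 h3
      have hs : q.σ (y : L) = algebraMap K L α - algebraMap K L β * q.r := by
        rw [hαβ]; simp [q.hσ]; ring
      have e1 : w.valuation L (algebraMap K L α) ≤ w.valuation L (y : L) := by
        have : (2 : L) * algebraMap K L α = y + q.σ y := by rw [hs, hαβ]; ring
        calc _ = w.valuation L ((2 : L) * algebraMap K L α) := by rw [map_mul, h2, one_mul]
          _ ≤ _ := by
            rw [this]
            exact Valuation.map_add_le _ le_rfl (hy w hw').le
      have e2 : w.valuation L (algebraMap K L β) ≤ w.valuation L (y : L) := by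
        have : (2 : L) * algebraMap K L β * q.r = y - q.σ y := by rw [hs, hαβ]; ring
        calc _ = w.valuation L ((2 : L) * algebraMap K L β * q.r) := by rw [map_mul, map_mul, h2, one_mul, hr, mul_one]
          _ ≤ _ := by
            rw [this]
            exact Valuation.map_sub_le (v := w.valuation L) le_rfl (hy w hw').le
      apply le_antisymm _ (max_le e1 e2)
      conv_lhs => rw [hαβ]
      refine (Valuation.map_add _ _ _).trans ?_
      rw [map_mul, hr, mul_one]
    have ne0 : ∀ γ : K, (∀ w : Pl L, w.under (𝓞 K) = v → w.valuation L (y : L) = w.valuation L (algebraMap K L γ)) → γ ≠ 0 := by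
      rintro γ h rfl
      obtain ⟨w, hw⟩ := exists_above L v
      have := h w hw
      rw [map_zero, map_zero, Valuation.zero_iff] at this
      exact y.ne_zero this
    rcases le_total (v.valuation K α) (v.valuation K β) with h | h
    · have hh : ∀ w : Pl L, w.under (𝓞 K) = v → w.valuation L (y : L) = w.valuation L (algebraMap K L β) := by
        intro w hw
        rw [main w hw]
        exact max_eq_right (over_le.2 (by rw [hw]; exact h))
      exact ⟨Units.mk0 β (ne0 β hh), fun _ w hw => (hh w hw).symm⟩
    · have hh : ∀ w : Pl L, w.under (𝓞 K) = v → w.valuation L (y : L) = w.valuation L (algebraMap K L α) := by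
        intro w hw
        rw [main w hw]
        exact max_eq_left (over_le.2 (by rw [hw]; exact h))
      exact ⟨Units.mk0 α (ne0 α hh), fun _ w hw => (hh w hw).symm⟩
  choose γ hγ using key
  obtain ⟨c, hc⟩ := good_elt hS (fun v => log (v.valuation K (γ v : K))) (by
    refine ((finite_val y).image (fun w => w.under (𝓞 K))).subset ?_
    rintro v ⟨hv, hm⟩
    obtain ⟨w, hw⟩ := exists_above L v
    refine ⟨w, ?_, hw⟩
    intro h1
    apply hm
    have := hγ v hv w hw
    rw [h1, over_one, hw] at this
    simp only [this, log_one])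
  refine ⟨c, fun w hw => ?_⟩
  rw [mem_above] at hw
  rw [← hγ _ hw w rfl, over_eq, hc _ hw, exp_log]
  simp

lemma Quad.val_σ {a : Kˣ} (q : Quad K L a) {S : Finset (Pl K)} {x : Lˣ} (hx : x ∈ U (above L S)) :
    Units.map (q.σ : L →* L) x ∈ U (above L S) := by
  intro w hw
  have h1 := conj_val q.σ w (x : L)
  have h2 := hx (conj q.σ w) (by
    rw [SetLike.mem_coe, mem_above] at hw ⊢; rwa [conj_under])
  exact h1.symm.trans h2

/-- norm index of S-units -/
lemma Quad.index {a : Kˣ} (q : Quad K L a) {S : Finset (Pl K)} (hS : Good S) (ha : a ∈ U S) :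
    ∃ i : ℕ, (Nm (a : K)).relIndex (U S) ∣ i ∧ i * 2 ^ sK (above L S) * 2 = 4 ^ sK S := by
  set A := U (above L S) with hA
  let τ : A →* A := ((Units.map (q.σ : L →* L)).comp A.subtype).codRestrict A (fun x => q.val_σ x.2)
  have hτ : ∀ x : A, ((τ x : Lˣ) : L) = q.σ ((x : Lˣ) : L) := fun x => rfl
  have hττ : ∀ x : A, τ (τ x) = x := fun x => by ext; rw [hτ, hτ, q.invol]
  let N : A →* A := MonoidHom.id A * τ
  let D : A →* A := MonoidHom.id A / τ
  have hN : ∀ x, N x = x * τ x := fun x => rfl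
  have hD : ∀ x, D x = x / τ x := fun x => rfl
  have kN : ∀ x, x ∈ N.ker ↔ x * τ x = 1 := fun x => Iff.rfl
  have kD : ∀ x, x ∈ D.ker ↔ τ x = x := fun x => by
    rw [MonoidHom.mem_ker, hD, div_eq_one]; exact eq_comm
  let j : U S →* A := ((inc K L).comp (U S).subtype).codRestrict A (fun x w hw => by
    have : w.under (𝓞 K) ∉ S := by rwa [SetLike.mem_coe, mem_above] at hw
    exact over_one.2 (x.2 _ this))
  have hj : ∀ x, ((j x : Lˣ) : L) = algebraMap K L ((x : Kˣ) : K) := fun x => rfl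
  have jinj : Function.Injective j := by
    intro x y h
    have := congrArg (fun z : A => ((z : Lˣ) : L)) h
    simp only [hj] at this
    ext
    exact (algebraMap K L).injective this
  have jr : j.range = D.ker := by
    ext x
    rw [kD]
    constructor
    · rintro ⟨y, rfl⟩
      ext
      rw [hτ, hj, AlgEquiv.commutes]
    · intro h
      obtain ⟨α, hα⟩ := q.fixed (x := ((x : Lˣ) : L)) (by rw [← hτ, h])
      have hα0 : α ≠ 0 := by rintro rfl; rw [map_zero] at hα; exact (x : Lˣ).ne_zero hα.symm
      refine ⟨⟨Units.mk0 α hα0, ?_⟩, ?_⟩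
      · intro v hv
        obtain ⟨w, rfl⟩ := exists_above L v
        have h1 := x.2 w (by rw [SetLike.mem_coe, mem_above]; exact hv)
        exact over_one.1 ((congrArg _ hα).trans h1)
      · ext; exact hα
  have h3 : N.ker = D.range := by
    ext x
    rw [kN]
    constructor
    · intro h
      have h' : ((x : Lˣ) : L) * q.σ ((x : Lˣ) : L) = 1 := congrArg (fun z : A => ((z : Lˣ) : L)) h
      obtain ⟨y, hy⟩ := q.h90 h'
      obtain ⟨c, hc⟩ := q.match hS ha y (fun w hw => by
        have h1 : w.valuation L ((x : Lˣ) : L) = 1 := x.2 w hw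
        have h2 := congrArg (w.valuation L) hy
        rwa [map_mul, h1, one_mul] at h2)
      refine ⟨⟨y / inc K L c, ?_⟩, ?_⟩
      · intro w hw
        have := hc w hw
        have hy0 : w.valuation L (y : L) ≠ 0 := by simp
        change w.valuation L ((y : L) * (↑(inc K L c)⁻¹ : L)) = 1
        rw [Units.val_inv_eq_inv_val, map_mul, map_inv₀]
        change _ * (w.valuation L (algebraMap K L c))⁻¹ = 1
        rw [this, mul_inv_cancel₀ hy0]
      · rw [hD, div_eq_iff_eq_mul]
        ext
        have hc0 : algebraMap K L c ≠ 0 := by simp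
        change ((y / inc K L c : Lˣ) : L) = (x : Lˣ) * q.σ ((y / inc K L c : Lˣ) : L)
        rw [Units.val_div_eq_div_val, map_div₀]
        change (y : L) / (algebraMap K L c) = ((x : Lˣ) : L) * (_ / q.σ (algebraMap K L c))
        rw [AlgEquiv.commutes, ← mul_div_assoc, hy]
    · rintro ⟨y, rfl⟩
      rw [hD, map_div, hττ]
      simp
  have m1 : (-1 : Lˣ) ∈ A := neg_one_mem_U _
  have t1 : τ ⟨-1, m1⟩ = ⟨-1, m1⟩ := by ext; rw [hτ]; simp
  have H := herbrand N D (fun x hx => by rw [hN, (kD x).1 hx, sq])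
    (fun x hx => by
      have := (kN x).1 hx
      rw [hD, sq, div_eq_mul_inv, eq_inv_of_mul_eq_one_right this, inv_inv]) h3
    (fun x => by rw [kD, hN, map_mul, hττ, mul_comm])
    (card_tors' (A.subtype.comp (D.ker).subtype) (fun x y h => Subtype.ext (Subtype.ext h)) ⟨⟨-1, m1⟩, (kD _).2 t1⟩ rfl)
    (card_tors' (A.subtype.comp (N.ker).subtype) (fun x y h => Subtype.ext (Subtype.ext h)) ⟨⟨-1, m1⟩, (kN _).2 (by rw [t1]; ext; simp)⟩ rfl)
  have fr : Module.finrank ℤ (Additive D.ker) = Module.finrank ℤ (Additive (U S)) := by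
    rw [← jr]
    exact ((MulEquiv.toAdditive (MonoidHom.ofInjective jinj)).toIntLinearEquiv.finrank_eq).symm
  rw [fr] at H
  refine ⟨N.range.relIndex D.ker, ?_, ?_⟩
  · rw [← jr, ← Subgroup.index_comap, Subgroup.relIndex]
    apply Subgroup.index_dvd_of_le
    rintro x ⟨y, hy⟩
    rw [Subgroup.mem_subgroupOf]
    obtain ⟨α, β, hαβ⟩ := q.gen ((y : Lˣ) : L)
    refine ⟨α, β, ?_⟩
    have := congrArg (fun z : A => ((z : Lˣ) : L)) hy
    rw [hN] at this
    change ((y : Lˣ) : L) * q.σ ((y : Lˣ) : L) = algebraMap K L ((x : Kˣ) : K) at this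
    apply (algebraMap K L).injective
    change algebraMap K L ((x : Kˣ) : K) = _
    rw [← this, hαβ]
    simp only [map_add, map_mul, AlgEquiv.commutes, q.hσ, map_sub, map_pow, ← q.hr]
    ring
  · rw [← U_rank, ← U_rank, pow_succ, pow_succ, ← H]; ring
end
end CQ

namespace CQ
open IsDedekindDomain NumberField WithZero
universe u
set_option linter.unusedSectionVars false
set_option linter.unusedSimpArgs false
set_option linter.unusedVariables false
set_option linter.style.haveILetI false
variable {K : Type u} [Field K] [NumberField K]

section
variable {L : Type u} [Field L] [NumberField L] [Algebra K L]

lemma two_card [IsTotallyComplex K] : 2 * Fintype.card (InfinitePlace K) = Module.finrank ℚ K := by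
  rw [InfinitePlace.card_eq_nrRealPlaces_add_nrComplexPlaces, IsTotallyComplex.nrRealPlaces_eq_zero,
    IsTotallyComplex.finrank, zero_add]

lemma Quad.tc {a : Kˣ} (q : Quad K L a) [IsTotallyComplex K] : IsTotallyComplex L :=
  isTotallyComplex_of_algebra K L

lemma Quad.inf_card {a : Kˣ} (q : Quad K L a) [IsTotallyComplex K] :
    Fintype.card (InfinitePlace L) = 2 * Fintype.card (InfinitePlace K) := by
  haveI := q.tc
  have h1 := two_card (K := K)
  have h2 := two_card (K := L)
  have h3 := Module.finrank_mul_finrank ℚ K L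
  rw [q.fr] at h3
  omega

lemma Quad.split {a : Kˣ} (q : Quad K L a) {w : Pl L} (h : a ∈ Sq (w.under (𝓞 K))) : conj q.σ w ≠ w := by
  intro hw
  obtain ⟨z, ω, hω, hz⟩ := mem_Sq.1 h
  have hω' := inc_W (L := L) hω
  rw [mem_W] at hω'
  have hz0 : algebraMap K L z ≠ 0 := by simp
  set ρ : L := q.r / algebraMap K L z with hρ
  have hρ2 : ρ ^ 2 = algebraMap K L ω := by
    rw [hρ, div_pow, q.hr, ← hz]
    rw [Units.val_mul, Units.val_pow_eq_pow_val, map_mul, map_pow]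
    field_simp
  have hσρ : q.σ ρ = -ρ := by rw [hρ, map_div₀, q.hσ, AlgEquiv.commutes, neg_div]
  set θ : L := (ρ - 1) / 2 with hθ
  have hσθ : q.σ θ = -(θ + 1) := by
    rw [hθ, map_div₀, map_sub, hσρ, map_one, map_ofNat]; ring
  have h1 : θ * (θ + 1) * 4 = algebraMap K L ω - 1 := by rw [← hρ2, hθ]; ring
  have h2 : w.valuation L (θ + 1) = w.valuation L θ := by
    have := conj_val q.σ w θ
    rw [hw, hσθ, Valuation.map_neg] at this
    exact this.symm
  have h3 : w.valuation L θ < 1 := by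
    by_contra! h3
    have h4 : w.valuation L (θ * (θ + 1) * 4) < w.valuation L 4 := by rw [h1]; exact hω'
    rw [map_mul, map_mul, h2] at h4
    have h5 : 1 ≤ w.valuation L θ * w.valuation L θ := one_le_mul h3 h3
    have h6 : w.valuation L 4 ≤ w.valuation L θ * w.valuation L θ * w.valuation L 4 := by
      simpa using mul_le_mul_left h5 (w.valuation L 4)
    exact absurd h4 (not_lt.2 h6)
  have h4 : w.valuation L ((θ + 1) - θ) < 1 := Valuation.map_sub_lt (v := w.valuation L) (h2 ▸ h3) h3
  simp at h4

open Classical in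
/-- places of `S` where `a` is not a local square -/
noncomputable def nsp (S : Finset (Pl K)) (a : Kˣ) : Finset (Pl K) := S.filter (fun v => a ∉ Sq v)

lemma mem_nsp {S : Finset (Pl K)} {a : Kˣ} {v : Pl K} : v ∈ nsp S a ↔ v ∈ S ∧ a ∉ Sq v := by
  simp [nsp]

lemma Quad.above_card {a : Kˣ} (q : Quad K L a) (S : Finset (Pl K)) :
    2 * S.card ≤ (above L S).card + (nsp S a).card := by
  classical
  rw [Finset.card_eq_sum_card_fiberwise (f := fun w : Pl L => w.under (𝓞 K)) (t := S) (fun w hw => mem_above.1 hw),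
    nsp, Finset.card_filter, ← Finset.sum_add_distrib, mul_comm, ← smul_eq_mul]
  apply Finset.card_nsmul_le_sum
  intro v hv
  obtain ⟨w, hw⟩ := exists_above L v
  by_cases h : a ∉ Sq v
  · rw [if_pos h]
    have : 0 < ({b ∈ above L S | HeightOneSpectrum.under (𝓞 K) b = v} : Finset (Pl L)).card :=
      Finset.card_pos.2 ⟨w, by simp [mem_above, hw, hv]⟩
    omega
  · rw [if_neg h]
    rw [not_not, ← hw] at h
    have h1 := q.split h
    have : 1 < ({b ∈ above L S | HeightOneSpectrum.under (𝓞 K) b = v} : Finset (Pl L)).card :=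
      Finset.one_lt_card.2 ⟨conj q.σ w, by simp [mem_above, conj_under, hw, hv], w, by simp [mem_above, hw, hv], h1⟩
    omega
end

/-- Lemma C -/
lemma lemC [IsTotallyComplex K] {S : Finset (Pl K)} (hS : Good S) {a : Kˣ} (ha : a ∈ U S) (hn : a ∉ GSq K) :
    (Nm (a : K)).relIndex (U S) ≠ 0 ∧ (Nm (a : K)).relIndex (U S) * 2 ≤ 2 ^ (nsp S a).card := by
  obtain ⟨L, _, _, _, ⟨q⟩⟩ := exists_quad a hn
  obtain ⟨i, hi, h⟩ := q.index hS ha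
  have hi0 : i ≠ 0 := by
    rintro rfl
    have : 0 < 4 ^ sK S := by positivity
    omega
  have h1 : 2 * sK S ≤ sK (above L S) + (nsp S a).card := by
    have := q.above_card S
    have := q.inf_card
    unfold sK
    omega
  have h2 : i * 2 ≤ 2 ^ (nsp S a).card := by
    apply Nat.le_of_mul_le_mul_right _ (show 0 < 2 ^ sK (above L S) by positivity)
    calc i * 2 * 2 ^ sK (above L S) = 4 ^ sK S := by rw [← h]; ring
      _ = 2 ^ (2 * sK S) := by rw [pow_mul]; norm_num
      _ ≤ 2 ^ (sK (above L S) + (nsp S a).card) := Nat.pow_le_pow_right (by norm_num) h1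
      _ = _ := by rw [pow_add]; ring
  refine ⟨fun h0 => ?_, ?_⟩
  · rw [h0, zero_dvd_iff] at hi; exact hi0 hi
  · have := Nat.le_of_dvd (Nat.pos_of_ne_zero hi0) hi
    omega

/-- Lemma Z -/
lemma lemZ [IsTotallyComplex K] {a : Kˣ} (h : ∀ v : Pl K, a ∈ Sq v) : a ∈ GSq K := by
  by_contra hn
  obtain ⟨S, hS1, hS⟩ := exists_good (finite_val a).toFinset
  have ha : a ∈ U S := by
    intro v hv
    by_contra h'
    exact hv (hS1 (by simpa using h'))
  obtain ⟨h1, h2⟩ := lemC hS ha hn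
  have : nsp S a = ∅ := by
    ext v; simp [mem_nsp, h v]
  rw [this] at h2
  simp at h2
  omega
end CQ

namespace CQ
open IsDedekindDomain NumberField WithZero
universe u
set_option linter.unusedSectionVars false
set_option linter.unusedSimpArgs false
set_option linter.unusedVariables false
set_option linter.style.haveILetI false
variable {K : Type u} [Field K] [NumberField K]

lemma exp_small' {v : Pl K} (x : K) (hx : x ≠ 0) : ∃ n : ℕ, (exp (-(n : ℤ)) : ℤᵐ⁰) < v.valuation K x := by
  have hx' : v.valuation K x ≠ 0 := by simpa using hx
  refine ⟨(-log (v.valuation K x) + 1).toNat, ?_⟩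
  rw [← exp_log hx', exp_lt_exp, log_exp]
  omega

lemma small_nat (T : Finset (Pl K)) (y : Pl K → K) (hy : ∀ v ∈ T, y v ≠ 0) :
    ∃ N : ℕ, 0 < N ∧ ∀ v ∈ T, v.valuation K (N : K) < v.valuation K (y v) := by
  classical
  have h : ∀ v : Pl K, ∃ n : ℕ, v ∈ T → (exp (-(n : ℤ)) : ℤᵐ⁰) < v.valuation K (y v) := by
    intro v
    by_cases hv : v ∈ T
    · obtain ⟨n, hn⟩ := exp_small' (v := v) (y v) (hy v hv)
      exact ⟨n, fun _ => hn⟩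
    · exact ⟨0, fun h => absurd h hv⟩
  choose n hn using h
  have nat_le : ∀ (v : Pl K) (m : ℕ), v.valuation K (m : K) ≤ 1 := by
    intro v m
    have := v.valuation_le_one (K := K) (m : 𝓞 K)
    simpa using this
  refine ⟨∏ v ∈ T, (Ideal.absNorm v.asIdeal) ^ n v, ?_, ?_⟩
  · apply Finset.prod_pos
    intro v _
    exact pow_pos (absNorm_pos v) _
  · intro v hv
    rw [← Finset.mul_prod_erase T _ hv, Nat.cast_mul, map_mul]
    have h1 : v.valuation K (((Ideal.absNorm v.asIdeal ^ n v : ℕ)) : K) ≤ exp (-(n v : ℤ)) := by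
      have h2 : ((Ideal.absNorm v.asIdeal : ℕ) : 𝓞 K) ^ n v ∈ v.asIdeal ^ n v :=
        Ideal.pow_mem_pow (Ideal.absNorm_mem _) _
      rw [mem_pow_iff] at h2
      simpa using h2
    calc _ ≤ exp (-(n v : ℤ)) * 1 := mul_le_mul' h1 (nat_le _ _)
      _ < _ := by rw [mul_one]; exact hn v hv

lemma exists_not_mem (T : Finset (Pl K)) : ∃ v : Pl K, v ∉ T := by
  by_contra! h
  obtain ⟨N, hN, hs⟩ := small_nat T (fun _ => 1) (fun _ _ => one_ne_zero)
  have hN1 : ((N : K) + 1) ≠ 0 := by exact_mod_cast (Nat.succ_ne_zero N)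
  obtain ⟨r, hr⟩ := exists_oUnit (x := Units.mk0 _ hN1) (fun v => by
    rw [Units.val_mk0]
    apply val_one_of_lt
    simpa using hs v (h v))
  have hr' : algebraMap (𝓞 K) K (r : 𝓞 K) = N + 1 := congrArg Units.val hr
  have hr2 : (r : 𝓞 K) = ((N + 1 : ℕ) : 𝓞 K) := by
    apply IsFractionRing.injective (𝓞 K) K
    rw [hr']; simp
  have hu : IsUnit (((N + 1 : ℕ) : 𝓞 K)) := hr2 ▸ r.isUnit
  have hu2 : IsUnit (algebraMap ℤ (𝓞 K) ((N + 1 : ℕ) : ℤ)) := by simpa using hu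
  have h3 := hu2.map (Algebra.norm ℤ)
  rw [Algebra.norm_algebraMap, isUnit_pow_iff Module.finrank_pos.ne', Int.isUnit_iff] at h3
  omega

lemma approx (T : Finset (Pl K)) (x y : Pl K → K) (hy : ∀ v ∈ T, y v ≠ 0) :
    ∃ c : K, ∀ v ∈ T, v.valuation K (c - x v) < v.valuation K (y v) := by
  classical
  have h0 : ∀ v, ∃ p q : 𝓞 K, q ≠ 0 ∧ x v = algebraMap (𝓞 K) K p / algebraMap (𝓞 K) K q := by
    intro v
    obtain ⟨p, q, hq, h⟩ := IsFractionRing.div_surjective (A := 𝓞 K) (x v)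
    exact ⟨p, q, nonZeroDivisors.ne_zero hq, h.symm⟩
  choose p q hq hpq using h0
  set D : 𝓞 K := ∏ v ∈ T, q v with hD
  have hD0 : algebraMap (𝓞 K) K D ≠ 0 := by
    rw [Ne, FaithfulSMul.algebraMap_eq_zero_iff]
    exact Finset.prod_ne_zero_iff.2 (fun v _ => hq v)
  have h : ∀ v : Pl K, ∃ n : ℕ, v ∈ T → (exp (-(n : ℤ)) : ℤᵐ⁰) < v.valuation K (algebraMap (𝓞 K) K D * y v) := by
    intro v
    by_cases hv : v ∈ T
    · obtain ⟨n, hn⟩ := exp_small' (v := v) (algebraMap (𝓞 K) K D * y v) (mul_ne_zero hD0 (hy v hv))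
      exact ⟨n, fun _ => hn⟩
    · exact ⟨0, fun h => absurd h hv⟩
  choose n hn using h
  obtain ⟨r, hr⟩ := IsDedekindDomain.exists_forall_sub_mem_ideal (s := T) (fun v : Pl K => v.asIdeal) n
    (fun v _ => v.prime) (fun v _ w _ hvw h => hvw (HeightOneSpectrum.ext h))
    (fun v => p v * ∏ u ∈ T.erase v, q u)
  refine ⟨algebraMap (𝓞 K) K r / algebraMap (𝓞 K) K D, fun v hv => ?_⟩
  have h1 := hr v hv
  rw [mem_pow_iff] at h1
  have hDv : v.valuation K (algebraMap (𝓞 K) K D) ≠ 0 := by simpa using hD0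
  have h2 : algebraMap (𝓞 K) K D * (algebraMap (𝓞 K) K r / algebraMap (𝓞 K) K D - x v) =
      ((r - p v * ∏ u ∈ T.erase v, q u : 𝓞 K) : K) := by
    have hqv : algebraMap (𝓞 K) K (q v) ≠ 0 := by
      rw [Ne, FaithfulSMul.algebraMap_eq_zero_iff]; exact hq v
    have h3 : algebraMap (𝓞 K) K D = algebraMap (𝓞 K) K (q v) * algebraMap (𝓞 K) K (∏ u ∈ T.erase v, q u) := by
      rw [hD, ← Finset.mul_prod_erase T _ hv, map_mul]
    rw [mul_sub, mul_div_cancel₀ _ hD0, hpq v, h3]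
    change _ = algebraMap (𝓞 K) K _
    rw [map_sub, map_mul]
    field_simp
  have h4 := lt_of_le_of_lt h1 (hn v hv)
  rw [← h2, map_mul, map_mul] at h4
  exact lt_of_mul_lt_mul_left' h4

lemma approxU (T : Finset (Pl K)) (x : Pl K → Kˣ) (e : K) (he : e ≠ 0) :
    ∃ c : Kˣ, ∀ v ∈ T, v.valuation K ((c : K) / x v - 1) < v.valuation K e := by
  classical
  rcases T.eq_empty_or_nonempty with rfl | ⟨v₀, hv₀⟩
  · exact ⟨1, by simp⟩
  obtain ⟨c, hc⟩ := approx T (fun v => x v) (fun v => if v.valuation K e ≤ 1 then x v * e else x v) (by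
    intro v _; split_ifs <;> simp [he])
  have hx : ∀ v : Pl K, v.valuation K (x v : K) ≠ 0 := fun v => by simp
  have key : ∀ v ∈ T, v.valuation K (c / x v - 1) < v.valuation K e ∧ v.valuation K (c / x v - 1) < 1 := by
    intro v hv
    have e1 : v.valuation K (c / x v - 1) * v.valuation K (x v : K) = v.valuation K (c - x v) := by
      rw [← map_mul]; congr 1; field_simp
    have h := hc v hv
    rw [← e1] at h
    split_ifs at h with h'
    · rw [map_mul, mul_comm] at h
      have := lt_of_mul_lt_mul_left' h
      exact ⟨this, lt_of_lt_of_le this h'⟩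
    · have h2 : v.valuation K (c / x v - 1) < 1 := by
        apply lt_of_mul_lt_mul_right' (a := v.valuation K (x v : K))
        simpa using h
      exact ⟨h2.trans (not_le.1 h'), h2⟩
  have hc0 : c ≠ 0 := by
    rintro rfl
    have := (key v₀ hv₀).2
    simp [Valuation.map_neg] at this
  exact ⟨Units.mk0 c hc0, fun v hv => (key v hv).1⟩

lemma approxW (T : Finset (Pl K)) (x : Pl K → Kˣ) : ∃ c : Kˣ, ∀ v ∈ T, c / x v ∈ W v := by
  obtain ⟨c, hc⟩ := approxU T x 4 (by norm_num)
  refine ⟨c, fun v hv => ?_⟩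
  have := hc v hv
  rw [mem_W]
  simpa using this

lemma val_sq_ne {v : Pl K} {x : Kˣ} (hx : v.valuation K (x : K) = exp (-1 : ℤ)) : x ∉ GSq K := by
  rintro ⟨z, rfl⟩
  have hz : v.valuation K (z : K) ≠ 0 := by simp
  have h : v.valuation K (z : K) ^ 2 = exp (-1 : ℤ) := by rw [← hx]; simp
  rw [← exp_log hz, ← exp_nsmul, exp_inj] at h
  simp at h
  omega

section
variable {L : Type u} [Field L] [NumberField L] [Algebra K L]
lemma Quad.inc_sq {a : Kˣ} (q : Quad K L a) {x : Kˣ} (h : inc K L x ∈ GSq L) : x ∈ GSq K ∨ x * a ∈ GSq K := by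
  obtain ⟨z, hz⟩ := h
  have hz' : (z : L) ^ 2 = algebraMap K L x := congrArg Units.val hz
  obtain ⟨α, β, hαβ⟩ := q.gen z
  have h1 : (q.σ z) ^ 2 = (z : L) ^ 2 := by rw [← map_pow, hz', AlgEquiv.commutes]
  have hs : q.σ (z : L) = algebraMap K L α - algebraMap K L β * q.r := by
    rw [hαβ]; simp [q.hσ]; ring
  rcases sq_eq_sq_iff_eq_or_eq_neg.1 h1 with h2 | h2
  · left
    obtain ⟨γ, hγ⟩ := q.fixed h2
    have h3 : γ ^ 2 = x := (algebraMap K L).injective (by rw [map_pow, hγ, hz'])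
    have hγ0 : γ ≠ 0 := by rintro rfl; exact x.ne_zero (by rw [← h3]; simp)
    exact ⟨Units.mk0 γ hγ0, by ext; simpa using h3⟩
  · right
    obtain ⟨γ, hγ⟩ := q.fixed (x := (z : L) * q.r) (by rw [map_mul, h2, q.hσ]; ring)
    have h3 : γ ^ 2 = x * a := (algebraMap K L).injective (by rw [map_pow, hγ, mul_pow, hz', q.hr, map_mul])
    have hγ0 : γ ≠ 0 := by rintro rfl; exact (x * a).ne_zero (by rw [Units.val_mul, ← h3]; simp)
    exact ⟨Units.mk0 γ hγ0, by ext; simpa using h3⟩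

lemma Quad.inc_r {a : Kˣ} (q : Quad K L a) : q.r ^ 2 = inc K L a := by ext; simp [q.hr]

lemma Quad.inc_mul {a : Kˣ} (q : Quad K L a) {w : Pl L} {x : Kˣ} (h : x * a ∈ Sq (w.under (𝓞 K))) : inc K L x ∈ Sq w := by
  have h1 := inc_Sq (L := L) h
  rw [map_mul, ← q.inc_r] at h1
  exact (Subgroup.mul_mem_cancel_right _ (sq_mem_Sq w q.r)).1 h1
end

/-- Lemma R -/
lemma lemR [IsTotallyComplex K] {a u : Kˣ} (ha : a ∉ GSq K) (hu : u ∉ GSq K) (hua : u * a ∉ GSq K)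
    (S : Finset (Pl K)) : ∃ v ∉ S, a ∈ Sq v ∧ u ∉ Sq v := by
  classical
  by_contra! hcon
  obtain ⟨L, _, _, _, ⟨q⟩⟩ := exists_quad a ha
  haveI := q.tc
  set two : Kˣ := Units.mk0 2 two_ne_zero
  set B := S ∪ (finite_val two).toFinset ∪ (finite_val u).toFinset ∪ (finite_val a).toFinset with hB
  have hB' : ∀ v ∉ B, v ∉ S ∧ v.valuation K 2 = 1 ∧ v.valuation K (u : K) = 1 ∧ v.valuation K (a : K) = 1 := by
    intro v hv
    simp [hB] at hv
    exact ⟨hv.1, by simpa [two] using hv.2.1, hv.2.2.1, hv.2.2.2⟩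
  set T := above L B with hT
  set u' := inc K L u with hu'
  have out : ∀ w ∉ T, u' ∈ Sq w := by
    intro w hw
    rw [hT, mem_above] at hw
    obtain ⟨h1, h2, h3, h4⟩ := hB' _ hw
    by_cases h5 : a ∈ Sq (w.under (𝓞 K))
    · exact inc_Sq (hcon _ h1 h5)
    by_cases h6 : u ∈ Sq (w.under (𝓞 K))
    · exact inc_Sq h6
    exact q.inc_mul (odd_mul_Sq h2 h3 h4 h6 h5)
  have hu'n : u' ∉ GSq L := by
    intro h
    rcases q.inc_sq h with h | h
    · exact hu h
    · exact hua h
  obtain ⟨w₀, hw₀⟩ := exists_not_mem T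
  obtain ⟨p, hp⟩ := exists_unif w₀
  obtain ⟨m, hm⟩ := approxW (insert w₀ T) (fun w => if w = w₀ then p else u')
  have hm0 : w₀.valuation L (m : L) = exp (-1 : ℤ) := by
    have := W_val (hm w₀ (by simp))
    rw [if_pos rfl, Units.val_div_eq_div_val, map_div₀, hp, div_eq_one_iff_eq (by simp)] at this
    exact this
  have hmT : ∀ w ∈ T, m / u' ∈ W w := by
    intro w hw
    have := hm w (by simp [hw])
    rwa [if_neg (by rintro rfl; exact hw₀ hw)] at this
  have hu1 : w₀.valuation L (u' : L) = 1 := by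
    rw [hT, mem_above] at hw₀
    exact over_one.2 (hB' _ hw₀).2.2.1
  have hmn : m ∉ GSq L := val_sq_ne hm0
  have hmu : u' * m ∉ GSq L := val_sq_ne (v := w₀) (by rw [Units.val_mul, map_mul, hu1, hm0, one_mul])
  obtain ⟨M, _, _, _, ⟨q'⟩⟩ := exists_quad m hmn
  haveI := q'.tc
  have : inc L M u' ∈ GSq M := by
    apply lemZ
    intro w
    by_cases hw : w.under (𝓞 L) ∈ T
    · apply q'.inc_mul
      have h1 := W_le_Sq _ (hmT _ hw)
      have h2 : u' * m = u' ^ 2 * (m / u') := by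
        rw [sq, mul_assoc, mul_div_cancel]
      rw [h2]
      exact mul_mem (sq_mem_Sq _ _) h1
    · exact inc_Sq (out _ hw)
  rcases q'.inc_sq this with h | h
  · exact hu'n h
  · exact hmu h
end CQ

namespace CQ
open IsDedekindDomain NumberField WithZero
universe u
set_option linter.unusedSectionVars false
set_option linter.unusedSimpArgs false
set_option linter.unusedVariables false
set_option linter.style.haveILetI false
variable {K : Type u} [Field K] [NumberField K]

lemma relIndex_le_two {A : Type*} [CommGroup A] (H G : Subgroup A) (h : ∀ x ∈ G, ∀ y ∈ G, x ∉ H → y ∉ H → x * y ∈ H) :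
    H.relIndex G ≠ 0 ∧ H.relIndex G ≤ 2 := by
  by_cases hG : G ≤ H
  · rw [Subgroup.relIndex_eq_one.2 hG]; norm_num
  · obtain ⟨g, hg, hgH⟩ := SetLike.not_le_iff_exists.1 hG
    have : H.relIndex G = 2 := by
      rw [Subgroup.relIndex, Subgroup.index_eq_two_iff]
      refine ⟨⟨g, hg⟩, fun b => ?_⟩
      simp only [Subgroup.mem_subgroupOf]
      by_cases hb : (b : A) ∈ H
      · right
        refine ⟨hb, fun h' => hgH ?_⟩
        exact (Subgroup.mul_mem_cancel_left _ hb).1 h'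
      · left
        exact ⟨h _ b.2 _ hg hb hgH, hb⟩
    rw [this]; norm_num

lemma GSq_relIndex (S : Finset (Pl K)) : (GSq K).relIndex (U S) = 2 ^ sK S := by
  rw [← U_index, Subgroup.relIndex]
  congr 1
  ext x
  rw [Subgroup.mem_subgroupOf]
  constructor
  · rintro ⟨z, hz⟩
    refine ⟨⟨z, ?_⟩, Subtype.ext hz⟩
    intro v hv
    have h1 : v.valuation K ((x : Kˣ) : K) = 1 := x.2 v hv
    rw [← hz] at h1
    simp only [powMonoidHom_apply, Units.val_pow_eq_pow_val, map_pow] at h1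
    exact (pow_eq_one_iff_of_nonneg zero_le two_ne_zero).1 h1
  · rintro ⟨y, rfl⟩
    exact ⟨y, rfl⟩

/-- locally square at all places of `R` -/
def Hs (R : Finset (Pl K)) : Subgroup Kˣ := ⨅ v ∈ R, Sq v

lemma mem_Hs {R : Finset (Pl K)} {x : Kˣ} : x ∈ Hs R ↔ ∀ v ∈ R, x ∈ Sq v := by
  simp [Hs, Subgroup.mem_iInf]

lemma Hs_insert [DecidableEq (Pl K)] (R : Finset (Pl K)) (v : Pl K) : Hs (insert v R) = Sq v ⊓ Hs R := by
  rw [Hs, Finset.iInf_insert]; rfl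

lemma Hs_relIndex {S : Finset (Pl K)} (hS : Good S) (R : Finset (Pl K)) (hR : ∀ v ∈ R, v ∉ S) :
    (Hs R).relIndex (U S) ≠ 0 ∧ (Hs R).relIndex (U S) ≤ 2 ^ R.card := by
  classical
  induction R using Finset.induction_on with
  | empty => simp [Hs]
  | insert v R hv ih =>
    obtain ⟨h1, h2⟩ := ih (fun w hw => hR w (by simp [hw]))
    have hvS := hR v (by simp)
    obtain ⟨h3, h4⟩ := relIndex_le_two (Sq v) (U S) (fun x hx y hy => odd_mul_Sq (hS.odd v hvS) (hx v hvS) (hy v hvS))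
    rw [Hs_insert, Finset.card_insert_of_notMem hv]
    refine ⟨Subgroup.relIndex_inf_ne_zero h3 h1, (Subgroup.relIndex_inf_le ..).trans ?_⟩
    rw [pow_succ, mul_comm]
    exact Nat.mul_le_mul h2 h4

lemma exists_R [IsTotallyComplex K] {S : Finset (Pl K)} (hS : Good S) {a : Kˣ} (ha : a ∈ U S) (hn : a ∉ GSq K)
    (j : ℕ) (hj : j + 1 ≤ sK S) : ∃ R : Finset (Pl K), (∀ v ∈ R, v ∉ S) ∧ R.card = j ∧ (∀ v ∈ R, a ∈ Sq v) ∧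
      ∀ E : Set (Pl K), ∃ x ∈ U S, ∀ v ∈ R, (x ∈ Sq v ↔ v ∉ E) := by
  classical
  induction j with
  | zero => exact ⟨∅, by simp, rfl, by simp, fun E => ⟨1, one_mem _, by simp⟩⟩
  | succ j ih =>
    obtain ⟨R, hR1, hR2, hR3, hR4⟩ := ih (by omega)
    obtain ⟨u, huU, huR, hu1, hu2⟩ : ∃ u ∈ U S, u ∈ Hs R ∧ u ∉ GSq K ∧ u * a ∉ GSq K := by
      by_contra! hcon
      have h1 := relIndex_le_two (GSq K) (Hs R ⊓ U S) (by
        rintro x ⟨hx1, hx2⟩ y ⟨hy1, hy2⟩ hx hy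
        have e1 := hcon x hx2 hx1 hx
        have e2 := hcon y hy2 hy1 hy
        have e3 : a ^ 2 ∈ GSq K := ⟨a, rfl⟩
        have e4 : x * y = (x * a) * (y * a) / a ^ 2 := by
          rw [eq_div_iff_mul_eq', sq]; ac_rfl
        rw [e4]
        exact div_mem (mul_mem e1 e2) e3)
      have h2 := Hs_relIndex hS R hR1
      have h3 := GSq_relIndex S
      have le1 : GSq K ⊓ U S ≤ Hs R ⊓ U S := inf_le_inf_right _ (by
        rintro _ ⟨z, rfl⟩
        exact mem_Hs.2 fun v _ => sq_mem_Sq v z)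
      have h4 := Subgroup.relIndex_mul_relIndex _ _ _ le1 (inf_le_right : Hs R ⊓ U S ≤ U S)
      rw [Subgroup.inf_relIndex_right, Subgroup.inf_relIndex_right, h3] at h4
      have h5 : (GSq K ⊓ U S).relIndex (Hs R ⊓ U S) = (GSq K).relIndex (Hs R ⊓ U S) := by
        rw [← Subgroup.inf_relIndex_right (GSq K ⊓ U S), ← Subgroup.inf_relIndex_right (GSq K)]
        congr 1
        apply le_antisymm
        · exact inf_le_inf_right _ inf_le_left
        · exact fun x hx => ⟨⟨hx.1, hx.2.2⟩, hx.2⟩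
      rw [h5] at h4
      have h6 : 2 ^ sK S ≤ 2 * 2 ^ j := by
        rw [← h4]
        exact Nat.mul_le_mul h1.2 (hR2 ▸ h2.2)
      rw [← pow_succ', Nat.pow_le_pow_iff_right (by norm_num)] at h6
      omega
    obtain ⟨v, hv, hav, huv⟩ := lemR hn hu1 hu2 (S ∪ R)
    simp only [Finset.mem_union, not_or] at hv
    refine ⟨insert v R, ?_, ?_, ?_, ?_⟩
    · intro w hw
      rcases Finset.mem_insert.1 hw with rfl | hw
      · exact hv.1
      · exact hR1 w hw
    · rw [Finset.card_insert_of_notMem hv.2, hR2]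
    · intro w hw
      rcases Finset.mem_insert.1 hw with rfl | hw
      · exact hav
      · exact hR3 w hw
    · intro E
      obtain ⟨x, hx, hxE⟩ := hR4 E
      by_cases h : x ∈ Sq v ↔ v ∉ E
      · refine ⟨x, hx, ?_⟩
        intro w hw
        rcases Finset.mem_insert.1 hw with rfl | hw
        · exact h
        · exact hxE w hw
      · refine ⟨x * u, mul_mem hx huU, ?_⟩
        intro w hw
        rcases Finset.mem_insert.1 hw with rfl | hw
        · by_cases hxv : x ∈ Sq w
          · have : x * u ∉ Sq w := fun h' => huv ((Subgroup.mul_mem_cancel_left _ hxv).1 h')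
            tauto
          · have := odd_mul_Sq (hS.odd w hv.1) (hx w hv.1) (huU w hv.1) hxv huv
            tauto
        · rw [Subgroup.mul_mem_cancel_right _ (mem_Hs.1 huR w hw)]
          exact hxE w hw

lemma R_surj {S R : Finset (Pl K)} [DecidableEq (Pl K)] (hS : Good S) (hR1 : ∀ v ∈ R, v ∉ S)
    (hR4 : ∀ E : Set (Pl K), ∃ x ∈ U S, ∀ v ∈ R, (x ∈ Sq v ↔ v ∉ E)) {v : Pl K} (hv : v ∈ R) (g : Kˣ) :
    ∃ x ∈ U (S ∪ R), x / g ∈ Sq v ∧ ∀ w ∈ R, w ≠ v → x ∈ Sq w := by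
  have hvS := hR1 v hv
  obtain ⟨π, hπ, hπ'⟩ := hS.unif v hvS
  have hg0 : v.valuation K (g : K) ≠ 0 := by simp
  set m : ℤ := - log (v.valuation K (g : K)) with hm
  set h : Kˣ := g / π ^ m with hh
  have hh1 : v.valuation K (h : K) = 1 := by
    rw [hh, Units.val_div_eq_div_val, Units.val_zpow_eq_zpow_val, map_div₀, map_zpow₀, hπ, ← exp_zsmul,
      div_eq_one_iff_eq (by simp), hm]
    simp [exp_log hg0]
  obtain ⟨e, he, heE⟩ := hR4 {w | (w = v ∧ h ∉ Sq v) ∨ (w ≠ v ∧ π ^ m ∉ Sq w)}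
  refine ⟨e * π ^ m, mul_mem (U_mono Finset.subset_union_left he) (zpow_mem ?_ _), ?_, ?_⟩
  · intro w hw
    have hw' : w ∉ S ∧ w ∉ R := by simpa using hw
    exact hπ' w hw'.1 (by rintro rfl; exact hw'.2 hv)
  · have e1 : e * π ^ m / g = (e * h) / h ^ 2 := by
      have : g = h * π ^ m := by rw [hh]; simp
      rw [this, div_eq_div_iff_mul_eq_mul, sq]; ac_rfl
    rw [e1]
    refine div_mem ?_ (sq_mem_Sq v h)
    have h1 := heE v hv
    by_cases h2 : h ∈ Sq v
    · refine mul_mem (h1.2 ?_) h2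
      simp [h2]
    · refine odd_mul_Sq (hS.odd v hvS) (he v hvS) hh1 ?_ h2
      rw [h1]; simp [h2]
  · intro w hw hwv
    have h1 := heE w hw
    have hwS := hR1 w hw
    by_cases h2 : π ^ m ∈ Sq w
    · refine mul_mem (h1.2 ?_) h2
      simp [h2, hwv]
    · refine odd_mul_Sq (hS.odd w hwS) (he w hwS) ?_ ?_ h2
      · rw [Units.val_zpow_eq_zpow_val, map_zpow₀, hπ' w hwS hwv, one_zpow]
      · rw [h1]; simp [h2, hwv]

lemma indep {A ι : Type*} [CommGroup A] [DecidableEq ι] (N : ι → Subgroup A) (G : Subgroup A) (T : Finset ι)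
    (h : ∀ i ∈ T, ∃ x ∈ G, x ∉ N i ∧ ∀ j ∈ T, j ≠ i → x ∈ N j) :
    (⨅ i ∈ T, N i).relIndex G = 0 ∨ 2 ^ T.card ≤ (⨅ i ∈ T, N i).relIndex G := by
  induction T using Finset.induction_on with
  | empty => simp
  | insert i T hi ih =>
    rw [Finset.iInf_insert, Finset.card_insert_of_notMem hi]
    by_cases h0 : (N i ⊓ ⨅ j ∈ T, N j).relIndex G = 0
    · exact Or.inl h0
    right
    set I := ⨅ j ∈ T, N j with hI
    have ih' := ih (fun j hj => by
      obtain ⟨x, hx, h1, h2⟩ := h j (by simp [hj])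
      exact ⟨x, hx, h1, fun k hk hkj => h2 k (by simp [hk]) hkj⟩)
    obtain ⟨x, hx, h1, h2⟩ := h i (by simp)
    have hxI : x ∈ I := by
      rw [hI]; simp only [Subgroup.mem_iInf]
      intro j hj
      exact h2 j (by simp [hj]) (by rintro rfl; exact hi hj)
    have h4 := Subgroup.relIndex_mul_relIndex (N i ⊓ I ⊓ G) (I ⊓ G) G (inf_le_inf_right _ inf_le_right) inf_le_right
    rw [Subgroup.inf_relIndex_right, Subgroup.inf_relIndex_right] at h4
    rw [← h4] at h0 ⊢
    have h5 := left_ne_zero_of_mul h0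
    have h6 := right_ne_zero_of_mul h0
    have h7 : (N i ⊓ I ⊓ G).relIndex (I ⊓ G) ≠ 1 := by
      rw [Ne, Subgroup.relIndex_eq_one]
      intro hle
      exact h1 (hle ⟨hxI, hx⟩).1.1
    rw [pow_succ, mul_comm]
    exact Nat.mul_le_mul (by omega) (ih'.resolve_left h6)

/-- Lemma A -/
lemma lemA [IsTotallyComplex K] {S R : Finset (Pl K)} [DecidableEq (Pl K)] (hS : Good S) (hR1 : ∀ v ∈ R, v ∉ S)
    (hR4 : ∀ E : Set (Pl K), ∃ x ∈ U S, ∀ v ∈ R, (x ∈ Sq v ↔ v ∉ E)) {y : Kˣ} (hy : y ∈ U (S ∪ R))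
    (hyS : y ∈ Hs S) : y ∈ GSq K := by
  by_contra hn
  obtain ⟨h1, h2⟩ := lemC (hS.mono Finset.subset_union_left) hy hn
  set T := nsp (S ∪ R) y with hT
  have hTR : ∀ v ∈ T, v ∈ R ∧ y ∉ Sq v := by
    intro v hv
    rw [hT, mem_nsp, Finset.mem_union] at hv
    refine ⟨hv.1.resolve_left (fun h => hv.2 (mem_Hs.1 hyS v h)), hv.2⟩
  have h3 := indep (fun v => Ng v (y : K)) (U (S ∪ R)) T (by
    intro v hv
    obtain ⟨hvR, hyv⟩ := hTR v hv
    have hne := Ng_ne_top (hS.odd v (hR1 v hvR)) hyv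
    obtain ⟨g, hg⟩ : ∃ g, g ∉ Ng v (y : K) := by
      by_contra! h
      exact hne (eq_top_iff.2 fun x _ => h x)
    obtain ⟨x, hx, hx1, hx2⟩ := R_surj hS hR1 hR4 hvR g
    refine ⟨x, hx, fun h => hg ?_, fun w hw hwv => Sq_le_Ng _ _ (hx2 w (hTR w hw).1 hwv)⟩
    have := Sq_le_Ng v (y : K) hx1
    have e : g = x / (x / g) := by simp
    rw [e]; exact div_mem h this)
  have h4 : (⨅ v ∈ T, Ng v (y : K)).relIndex (U (S ∪ R)) ∣ (Nm (y : K)).relIndex (U (S ∪ R)) :=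
    Subgroup.relIndex_dvd_of_le_left _ (le_iInf₂ fun v _ => Nm_le_Ng v _)
  have h5 := Nat.le_of_dvd (Nat.pos_of_ne_zero h1) h4
  rcases h3 with h3 | h3
  · rw [h3, zero_dvd_iff] at h4; exact h1 h4
  · omega
end CQ

namespace CQ
open IsDedekindDomain NumberField WithZero
universe u
set_option linter.unusedSectionVars false
set_option linter.unusedSimpArgs false
set_option linter.unusedVariables false
set_option linter.style.haveILetI false
variable {K : Type u} [Field K] [NumberField K]

lemma Hs_index (S : Finset (Pl K)) : (Hs S).index ≠ 0 ∧ (Hs S).index ≤ ∏ v ∈ S, (Sq v).index := by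
  classical
  induction S using Finset.induction_on with
  | empty => simp [Hs]
  | insert v S hv ih =>
    rw [Hs_insert, Finset.prod_insert hv]
    have h0 : (Sq v).index ≠ 0 := by
      haveI := (Sq_index v).1
      exact Subgroup.index_ne_zero_of_finite
    exact ⟨Subgroup.index_inf_ne_zero h0 ih.1, (Subgroup.index_inf_le).trans (Nat.mul_le_mul le_rfl ih.2)⟩

lemma relIndex_sup' {A : Type*} [CommGroup A] (H G : Subgroup A) : H.relIndex G * (H ⊔ G).index = H.index := by
  rw [← Subgroup.relIndex_mul_index (le_sup_left : H ≤ H ⊔ G), Subgroup.relIndex_sup_left]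

lemma nsp_union [DecidableEq (Pl K)] (S R : Finset (Pl K)) (a : Kˣ) (h : ∀ v ∈ R, a ∈ Sq v) :
    nsp (S ∪ R) a = nsp S a := by
  ext v
  rw [mem_nsp, mem_nsp, Finset.mem_union]
  constructor
  · rintro ⟨h1 | h1, h2⟩
    · exact ⟨h1, h2⟩
    · exact absurd (h v h1) h2
  · rintro ⟨h1, h2⟩; exact ⟨Or.inl h1, h2⟩

/-- Intersection of local norm groups. -/
def Is (S : Finset (Pl K)) (a : K) : Subgroup Kˣ := ⨅ v ∈ S, Ng v a

lemma mem_Is {S : Finset (Pl K)} {a : K} {x : Kˣ} : x ∈ Is S a ↔ ∀ v ∈ S, x ∈ Ng v a := by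
  simp [Is, Subgroup.mem_iInf]

lemma lemB [IsTotallyComplex K] {S : Finset (Pl K)} (hS : Good S) {a : Kˣ} (ha : a ∈ U S) (hn : a ∉ GSq K) :
    (Is (nsp S a) (a : K)).index ≠ 0 ∧ (Is (nsp S a) (a : K)).index ≤ 2 ^ (nsp S a).card ∧
    (2 ^ (nsp S a).card ≤ (Is (nsp S a) (a : K)).index → ∀ b ∈ U S, b ∈ Is (nsp S a) (a : K) → b ∈ Nm (a : K)) := by
  classical
  obtain ⟨s, hs⟩ : ∃ s, sK S = s + 1 := ⟨sK S - 1, by have := sK_pos S; omega⟩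
  obtain ⟨R, hR1, hR2, hR3, hR4⟩ := exists_R hS ha hn s (by omega)
  have hdisj : Disjoint S R := Finset.disjoint_right.2 hR1
  have hsU : sK (S ∪ R) = 2 * s + 1 := by
    have : sK (S ∪ R) = sK S + R.card := by
      rw [sK, sK, Finset.card_union_of_disjoint hdisj]; ring
    omega
  have hUU : U S ≤ U (S ∪ R) := U_mono Finset.subset_union_left
  set I := Is (nsp S a) (a : K) with hI
  have hHI : Hs S ≤ I := fun x hx => mem_Is.2 fun v hv => Sq_le_Ng v _ (mem_Hs.1 hx v (mem_nsp.1 hv).1)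
  have hNI : Nm (a : K) ≤ I := fun x hx => mem_Is.2 fun v hv => Nm_le_Ng v _ hx
  have hGH : GSq K ≤ Hs S := fun x hx => mem_Hs.2 fun v hv => Subgroup.mem_sup_left hx
  have h1 : (Hs S).relIndex (U (S ∪ R)) = 2 ^ (2 * s + 1) := by
    rw [← hsU, ← GSq_relIndex, Subgroup.relIndex, Subgroup.relIndex]
    congr 1
    ext x
    rw [Subgroup.mem_subgroupOf, Subgroup.mem_subgroupOf]
    exact ⟨fun h => lemA hS hR1 hR4 x.2 h, fun h => hGH h⟩
  have h2 : (Hs S).index ≤ 4 ^ (s + 1) := by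
    refine (Hs_index S).2.trans ((prod_index S).trans ?_)
    rw [← two_card, pow_mul, ← hs, sK, pow_add]; norm_num
  have h3 := relIndex_sup' (Hs S) (U (S ∪ R))
  have h4 : (Hs S ⊔ U (S ∪ R)).index ≤ 2 := by
    rw [h1] at h3
    have h5 : 2 ^ (2 * s + 1) * (Hs S ⊔ U (S ∪ R)).index ≤ 2 ^ (2 * s + 1) * 2 := by
      rw [h3]; refine h2.trans (le_of_eq ?_)
      rw [show (4 : ℕ) = 2 ^ 2 by norm_num, ← pow_mul, ← pow_succ]; ring_nf
    exact Nat.le_of_mul_le_mul_left h5 (by positivity)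
  have h40 : (Hs S ⊔ U (S ∪ R)).index ≠ 0 := by
    intro h; rw [h, mul_zero] at h3; exact (Hs_index S).1 h3.symm
  have h5 : (I ⊔ U (S ∪ R)).index ≤ 2 :=
    (Nat.le_of_dvd (Nat.pos_of_ne_zero h40) (Subgroup.index_dvd_of_le (sup_le_sup_right hHI _))).trans h4
  have hI0 : I.index ≠ 0 := by
    intro h
    have := Subgroup.index_dvd_of_le hHI
    rw [h, zero_dvd_iff] at this
    exact (Hs_index S).1 this
  obtain ⟨c1, c2⟩ := lemC (hS.mono Finset.subset_union_left) (hUU ha) hn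
  rw [nsp_union S R a hR3] at c2
  have h6 := relIndex_sup' I (U (S ∪ R))
  have h7 : I.relIndex (U (S ∪ R)) ∣ (Nm (a : K)).relIndex (U (S ∪ R)) :=
    Subgroup.relIndex_dvd_of_le_left _ hNI
  have h8 := Nat.le_of_dvd (Nat.pos_of_ne_zero c1) h7
  have h9 : I.index ≤ I.relIndex (U (S ∪ R)) * 2 := by rw [← h6]; exact Nat.mul_le_mul le_rfl h5
  refine ⟨hI0, by omega, fun hge b hb hbI => ?_⟩
  have h10 : (Nm (a : K)).relIndex (U (S ∪ R)) = I.relIndex (U (S ∪ R)) := by omega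
  have hle : (Nm (a : K)).subgroupOf (U (S ∪ R)) ≤ I.subgroupOf (U (S ∪ R)) := fun x hx => hNI hx
  have h11 := Subgroup.relIndex_mul_index hle
  have h12 : ((Nm (a : K)).subgroupOf (U (S ∪ R))).relIndex (I.subgroupOf (U (S ∪ R))) = 1 := by
    change _ * I.relIndex (U (S ∪ R)) = (Nm (a : K)).relIndex (U (S ∪ R)) at h11
    rw [h10] at h11 c1
    exact Nat.eq_of_mul_eq_mul_right (Nat.pos_of_ne_zero c1) (by rw [h11, one_mul])
  rw [Subgroup.relIndex_eq_one] at h12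
  exact h12 (show (⟨b, hUU hb⟩ : U (S ∪ R)) ∈ _ from hbI)

/-- the intersection over odd places has large index -/
lemma Is_index {a : Kˣ} (T : Finset (Pl K)) (hT : ∀ v ∈ T, v.valuation K 2 = 1 ∧ a ∉ Sq v) :
    (Is T (a : K)).index = 0 ∨ 2 ^ T.card ≤ (Is T (a : K)).index := by
  classical
  have := indep (fun v => Ng v (a : K)) ⊤ T (fun v hv => by
    have h := Ng_ne_top (hT v hv).1 (hT v hv).2
    obtain ⟨g, hg⟩ : ∃ g, g ∉ Ng v (a : K) := by
      by_contra! h'; exact h (by ext x; simp [h' x])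
    obtain ⟨c, hc⟩ := approxW T (fun w => if w = v then g else 1)
    refine ⟨c, trivial, ?_, ?_⟩
    · have := hc v hv
      simp only [if_pos] at this
      intro h'
      apply hg
      have h2 : c / g ∈ Ng v (a : K) := Subgroup.mem_sup_right this
      have := div_mem h' h2
      simpa using this
    · intro w hw hwv
      have := hc w hw
      simp only [if_neg hwv, div_one] at this
      exact Subgroup.mem_sup_right this)
  simpa [Is] using this

lemma lemB1 [IsTotallyComplex K] {S : Finset (Pl K)} (hS : Good S) {a : Kˣ} (ha : a ∈ U S) (hn : a ∉ GSq K)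
    (hodd : ∀ v ∈ S, a ∉ Sq v → v.valuation K 2 = 1) {b : Kˣ} (hb : b ∈ U S)
    (hbN : ∀ v ∈ S, a ∉ Sq v → b ∈ Ng v (a : K)) : b ∈ Nm (a : K) := by
  obtain ⟨h1, h2, h3⟩ := lemB hS ha hn
  refine h3 ((Is_index (a := a) (nsp S a) fun v hv => ?_).resolve_left h1) b hb (mem_Is.2 fun v hv => ?_)
  · exact ⟨hodd v (mem_nsp.1 hv).1 (mem_nsp.1 hv).2, (mem_nsp.1 hv).2⟩
  · exact hbN v (mem_nsp.1 hv).1 (mem_nsp.1 hv).2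

lemma lemB2 [IsTotallyComplex K] {S : Finset (Pl K)} (hS : Good S) {a : Kˣ} (ha : a ∈ U S) (hn : a ∉ GSq K)
    {v₀ : Pl K} (hv₀ : v₀ ∈ S) (ha₀ : a ∉ Sq v₀)
    (hodd : ∀ v ∈ S, v ≠ v₀ → a ∉ Sq v → v.valuation K 2 = 1) : (Ng v₀ (a : K)).index ≠ 0 ∧ (Ng v₀ (a : K)).index ≤ 2 := by
  classical
  obtain ⟨h1, h2, -⟩ := lemB hS ha hn
  have hm : v₀ ∈ nsp S a := mem_nsp.2 ⟨hv₀, ha₀⟩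
  set T := (nsp S a).erase v₀ with hT
  have hTi : nsp S a = insert v₀ T := (Finset.insert_erase hm).symm
  have hv₀T : v₀ ∉ T := Finset.notMem_erase _ _
  have hIs : Is (nsp S a) (a : K) = Ng v₀ (a : K) ⊓ Is T (a : K) := by
    rw [hTi, Is, Finset.iInf_insert]; rfl
  have hle : Is (nsp S a) (a : K) ≤ Is T (a : K) := hIs ▸ inf_le_right
  have hle' : Is (nsp S a) (a : K) ≤ Ng v₀ (a : K) := hIs ▸ inf_le_left
  have hI0 : (Is T (a : K)).index ≠ 0 := by
    intro h
    have := Subgroup.index_dvd_of_le hle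
    rw [h, zero_dvd_iff] at this; exact h1 this
  have hN0 : (Ng v₀ (a : K)).index ≠ 0 := by
    intro h
    have := Subgroup.index_dvd_of_le hle'
    rw [h, zero_dvd_iff] at this; exact h1 this
  refine ⟨hN0, ?_⟩
  have h3 : 2 ^ T.card ≤ (Is T (a : K)).index := (Is_index (a := a) T fun v hv => by
    rw [hT, Finset.mem_erase, mem_nsp] at hv
    exact ⟨hodd v hv.2.1 hv.1 hv.2.2, hv.2.2⟩).resolve_left hI0
  have htop : Ng v₀ (a : K) ⊔ Is T (a : K) = ⊤ := by
    rw [eq_top_iff]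
    rintro g -
    obtain ⟨c, hc⟩ := approxW (nsp S a) (fun w => if w = v₀ then g else 1)
    have e1 := hc v₀ hm
    simp only [if_pos] at e1
    have e2 : c ∈ Is T (a : K) := mem_Is.2 fun w hw => by
      have := hc w (Finset.mem_of_mem_erase hw)
      simp only [if_neg (Finset.ne_of_mem_erase hw), div_one] at this
      exact Subgroup.mem_sup_right this
    have : g = (c / g)⁻¹ * c := by simp
    rw [this]
    exact Subgroup.mul_mem_sup (inv_mem (Subgroup.mem_sup_right e1)) e2
  have h4 : (Ng v₀ (a : K)).relIndex (Is T (a : K)) = (Ng v₀ (a : K)).index := by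
    have := relIndex_sup' (Ng v₀ (a : K)) (Is T (a : K))
    rw [htop] at this; simpa using this
  have h5 := Subgroup.relIndex_mul_index hle
  rw [hIs, Subgroup.inf_relIndex_right, h4, ← hIs] at h5
  rw [hTi, Finset.card_insert_of_notMem hv₀T, ← hTi, ← h5, pow_succ'] at h2
  by_contra! h6
  have : 2 * 2 ^ T.card < (Ng v₀ (a : K)).index * (Is T (a : K)).index :=
    calc 2 * 2 ^ T.card < (Ng v₀ (a : K)).index * 2 ^ T.card := Nat.mul_lt_mul_of_pos_right h6 (by positivity)
      _ ≤ _ := Nat.mul_le_mul le_rfl h3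
  omega

end CQ

namespace CQ
open IsDedekindDomain NumberField WithZero
universe u
set_option linter.unusedSectionVars false
set_option linter.unusedSimpArgs false
set_option linter.unusedVariables false
set_option linter.style.haveILetI false
variable {K : Type u} [Field K] [NumberField K]

lemma tc_of_no_real (h : (K →+* ℝ) → False) : IsTotallyComplex K := by
  refine ⟨fun v => ?_⟩
  rw [← InfinitePlace.not_isReal_iff_isComplex]
  intro hv
  exact h (InfinitePlace.embedding_of_isReal hv)

lemma top_of_Sq {v : Pl K} {a : Kˣ} (ha : a ∈ Sq v) (c : Kˣ) : c ∈ Ng v (a : K) := by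
  have h0 : (4 : K) * c / ((c : K) - 1) ^ 2 ≠ 0 ∨ (c : K) = 1 := by
    by_cases h : (c : K) = 1
    · exact Or.inr h
    · left
      have : (c : K) - 1 ≠ 0 := sub_ne_zero.2 h
      exact div_ne_zero (mul_ne_zero (by norm_num) c.ne_zero) (pow_ne_zero _ this)
  rcases h0 with h0 | h0
  swap
  · have : c = 1 := Units.ext h0
    rw [this]; exact one_mem _
  have hc1 : (c : K) - 1 ≠ 0 := by
    intro h; rw [h] at h0; simp at h0
  have hx : (4 : K) * (4 * c / ((c : K) - 1) ^ 2) ≠ 0 := mul_ne_zero (by norm_num) h0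
  obtain ⟨z, w, rfl, hw⟩ := Sq_approx ha _ hx
  -- c = ((c+1)/2)^2 - ((c-1)/2)^2
  set n : K := (((c : K) + 1) / 2) ^ 2 - ((z ^ 2 * w : Kˣ) : K) * ((c - 1) / (2 * z)) ^ 2 with hn
  have hz : (z : K) ≠ 0 := z.ne_zero
  have hnc : n - c = - (((w : K) - 1) * ((c - 1) ^ 2 / 4)) := by
    rw [hn]; push_cast; field_simp; ring
  have hlt : v.valuation K (n - c) < v.valuation K 4 * v.valuation K (c : K) := by
    rw [hnc, Valuation.map_neg, map_mul]
    have hpos : 0 < v.valuation K (((c : K) - 1) ^ 2 / 4) := zero_lt_iff.2 (by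
      rw [Valuation.ne_zero_iff]; exact div_ne_zero (pow_ne_zero _ hc1) (by norm_num))
    refine (mul_lt_mul_of_pos_right hw hpos).trans_le (le_of_eq ?_)
    rw [← map_mul, ← map_mul]
    congr 1
    field_simp
  have hn0 : n ≠ 0 := by
    intro h
    rw [h, zero_sub, Valuation.map_neg] at hlt
    exact absurd hlt (not_lt.2 (mul_le_of_le_one_left' (v4_le v)))
  have hm := div_mem_W (v := v) (x := Units.mk0 n hn0) (y := c) hlt
  have e : c = Units.mk0 n hn0 * (Units.mk0 n hn0 / c)⁻¹ := by simp
  rw [e]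
  exact Subgroup.mul_mem_sup ⟨_, _, hn⟩ (inv_mem hm)

lemma v16_le (v : Pl K) : v.valuation K 16 ≤ v.valuation K 4 := by
  have : (16 : K) = 4 * 4 := by norm_num
  rw [this, map_mul]
  exact mul_le_of_le_one_left' (v4_le v)

lemma B2_tc [IsTotallyComplex K] (v₀ : Pl K) (a : Kˣ) {c c' : Kˣ} (hc : c ∉ Ng v₀ (a : K))
    (hc' : c' ∉ Ng v₀ (a : K)) : c * c' ∈ Ng v₀ (a : K) := by
  classical
  by_cases ha : a ∈ Sq v₀
  · exact absurd (top_of_Sq ha c) hc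
  set D := (finite_val (K := K) (Units.mk0 2 two_ne_zero)).toFinset with hD
  obtain ⟨a', ha'⟩ := approxU (insert v₀ D) (fun v => if v = v₀ then a else 1) 16 (by norm_num)
  have h1 : v₀.valuation K ((a' : K) / a - 1) < v₀.valuation K 16 := by simpa using ha' v₀ (by simp)
  have h1W : a' / a ∈ W v₀ := by
    rw [mem_W]; push_cast; exact h1.trans_le (v16_le v₀)
  have ha'0 : a' ∉ Sq v₀ := by
    intro h
    apply ha
    have := div_mem h (W_le_Sq v₀ h1W)
    simpa using this
  have hval : v₀.valuation K ((a' : K) / a) = 1 := by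
    have := W_val h1W; simpa using this
  have h2 : v₀.valuation K ((a : K) / a' - 1) < v₀.valuation K 16 := by
    have e : (a : K) / a' - 1 = - ((a' : K) / a - 1) / (a' / a) := by
      have := a.ne_zero; have := a'.ne_zero; field_simp; ring
    rw [e, map_div₀, hval, div_one, Valuation.map_neg]; exact h1
  have hN : Ng v₀ (a : K) = Ng v₀ (a' : K) := le_antisymm (Ng_stable ha h1) (Ng_stable ha'0 h2)
  rw [hN] at hc hc' ⊢
  obtain ⟨S, hS1, hS⟩ := exists_good (insert v₀ (finite_val a').toFinset)
  have haU : a' ∈ U S := by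
    intro v hv
    by_contra h
    exact hv (hS1 (by simp [h]))
  obtain ⟨i1, i2⟩ := lemB2 hS haU (fun h => ha'0 (Subgroup.mem_sup_left h)) (hS1 (by simp)) ha'0 (by
    intro v hv hvv h
    by_contra h2
    apply h
    have hm : v ∈ D := by rw [hD, Set.Finite.mem_toFinset]; exact h2
    have := ha' v (by simp [hm])
    simp only [if_neg hvv, Units.val_one, div_one] at this
    exact W_le_Sq v (this.trans_le (v16_le v)))
  have i3 : (Ng v₀ (a' : K)).index = 2 := by
    have : (Ng v₀ (a' : K)).index ≠ 1 := fun h => by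
      rw [Subgroup.index_eq_one] at h; rw [h] at hc; exact hc trivial
    omega
  rw [Subgroup.mul_mem_iff_of_index_two i3]
  tauto

section
variable {L : Type u} [Field L] [NumberField L] [Algebra K L]

lemma dense_K {μ : Kˣ} (q : Quad K L μ) {w : Pl L} (hμ : μ ∈ Sq (w.under (𝓞 K))) (x : L) (e : K) (he : e ≠ 0) :
    ∃ y : K, w.valuation L (x - algebraMap K L y) < w.valuation L (algebraMap K L e) := by
  obtain ⟨α, β, rfl⟩ := q.gen x
  by_cases hβ : β = 0
  · refine ⟨α, ?_⟩
    subst hβ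
    have : w.valuation L (algebraMap K L e) ≠ 0 := by
      rw [Valuation.ne_zero_iff]; simpa using he
    simpa using zero_lt_iff.2 this
  have he' : (e / β) ^ 2 ≠ 0 := by positivity
  -- need precision depending on z; use r itself
  have hkey : ∃ y : K, w.valuation L ((q.r : L) - algebraMap K L y) < w.valuation L (algebraMap K L (e / β)) := by
    have hm0 : (μ : K) ≠ 0 := μ.ne_zero
    obtain ⟨z', u', hzu', hu'⟩ := Sq_approx hμ (4 * ((e / β) ^ 2 / μ) * (if (w.under (𝓞 K)).valuation K ((e / β) ^ 2 / μ) ≤ 1 then 1 else ((e / β) ^ 2 / μ)⁻¹)) (by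
      have h40 : (4 : K) ≠ 0 := by norm_num
      split_ifs
      · exact mul_ne_zero (mul_ne_zero h40 (by positivity)) one_ne_zero
      · exact mul_ne_zero (mul_ne_zero h40 (by positivity)) (by positivity))
    have hu1 : (w.under (𝓞 K)).valuation K ((u' : K) - 1) < 1 := by
      refine hu'.trans_le ?_
      rw [map_mul, map_mul]
      have h4 := v4_le (w.under (𝓞 K))
      split_ifs with hh
      · rw [map_one, mul_one]; exact mul_le_one' h4 hh
      · rw [map_inv₀, mul_assoc, mul_inv_cancel₀, mul_one]
        · exact h4
        · rw [Valuation.ne_zero_iff]; positivity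
    have hu2 : (w.under (𝓞 K)).valuation K ((u' : K) - 1) < (w.under (𝓞 K)).valuation K ((e / β) ^ 2 / μ) := by
      refine hu'.trans_le ?_
      rw [map_mul, map_mul]
      have h4 := v4_le (w.under (𝓞 K))
      split_ifs with hh
      · rw [map_one, mul_one]; exact mul_le_of_le_one_left' h4
      · rw [map_inv₀, mul_assoc, mul_inv_cancel₀, mul_one]
        · exact h4.trans (not_le.1 hh).le
        · rw [Valuation.ne_zero_iff]; positivity
    have hvu : (w.under (𝓞 K)).valuation K (u' : K) = 1 := val_one_of_lt hu1
    have hprod : ((q.r : L) - algebraMap K L z') * ((q.r : L) - algebraMap K L (-z')) = algebraMap K L ((z' : K) ^ 2 * (u' - 1)) := by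
      have := q.hr
      have h2 : algebraMap K L (μ : K) = algebraMap K L ((z' ^ 2 * u' : Kˣ) : K) := congrArg (fun t : Kˣ => algebraMap K L (t : K)) hzu'
      rw [h2] at this
      push_cast at this
      simp only [map_neg, map_mul, map_sub, map_one, map_pow] at this ⊢
      linear_combination this
    have hlt : w.valuation L (algebraMap K L ((z' : K) ^ 2 * (u' - 1))) < w.valuation L (algebraMap K L (e / β)) ^ 2 := by
      rw [← map_pow, ← map_pow, over_lt, map_mul]
      have hz0 : 0 < (w.under (𝓞 K)).valuation K ((z' : K) ^ 2) := zero_lt_iff.2 (by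
        rw [Valuation.ne_zero_iff]; exact pow_ne_zero _ z'.ne_zero)
      refine (mul_lt_mul_of_pos_left hu2 hz0).trans_le (le_of_eq ?_)
      have : (w.under (𝓞 K)).valuation K ((z' : K) ^ 2) = (w.under (𝓞 K)).valuation K (μ : K) := by
        conv_rhs => rw [hzu']
        push_cast
        rw [map_mul, hvu, mul_one]
      rw [this, ← map_mul]
      congr 1
      field_simp
    by_contra! hcon
    have h1 := hcon z'
    have h2 := hcon (-z')
    rw [← hprod, map_mul, pow_two] at hlt
    exact absurd hlt (not_lt.2 (mul_le_mul' h1 h2))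
  obtain ⟨y, hy⟩ := hkey
  refine ⟨α + β * y, ?_⟩
  have : algebraMap K L α + algebraMap K L β * (q.r : L) - algebraMap K L (α + β * y) = algebraMap K L β * (q.r - algebraMap K L y) := by
    rw [map_add, map_mul]; ring
  rw [this, map_mul]
  have hb0 : 0 < w.valuation L (algebraMap K L β) := zero_lt_iff.2 (by
    rw [Valuation.ne_zero_iff]; simpa using hβ)
  refine (mul_lt_mul_of_pos_left hy hb0).trans_le (le_of_eq ?_)
  rw [← map_mul, ← map_mul]; congr 2; field_simp

end
end CQ

namespace CQ
open IsDedekindDomain NumberField WithZero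
universe u
set_option linter.unusedSectionVars false
set_option linter.unusedSimpArgs false
set_option linter.unusedVariables false
set_option linter.style.haveILetI false
variable {K : Type u} [Field K] [NumberField K]

section
variable {L : Type u} [Field L] [NumberField L] [Algebra K L]

lemma Ng_down {μ : Kˣ} (q : Quad K L μ) {w : Pl L} (hμ : μ ∈ Sq (w.under (𝓞 K))) {a : K} {c : Kˣ}
    (h : inc K L c ∈ Ng w (algebraMap K L a)) : c ∈ Ng (w.under (𝓞 K)) a := by
  obtain ⟨n, ⟨X, Y, hn⟩, u, hu, hc⟩ := mem_Ng.1 h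
  -- approximate X and Y
  have hcval : w.valuation L (n : L) = w.valuation L (algebraMap K L c) := by
    have := congrArg (fun t : Lˣ => w.valuation L (t : L)) hc
    simp only [Units.val_mul, map_mul, W_val hu, mul_one] at this
    exact this
  set ε : K := 4 * c with hε
  have hε0 : ε ≠ 0 := mul_ne_zero (by norm_num) c.ne_zero
  have hb : ∀ Z : L, ∀ s : K, s ≠ 0 → ∃ y : K, w.valuation L (Z ^ 2 - (algebraMap K L y) ^ 2) < w.valuation L (algebraMap K L s) := by
    intro Z s hs
    by_cases hZ : Z = 0
    · exact ⟨0, by subst hZ; simpa [zero_lt_iff] using hs⟩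
    -- find y close to Z within min(|s|/|Z|, |Z|)
    obtain ⟨y0, hy0⟩ : ∃ y0 : K, w.valuation L (algebraMap K L y0) = w.valuation L Z := by
      obtain ⟨e, he⟩ : ∃ e : K, e ≠ 0 ∧ w.valuation L (algebraMap K L e) ≤ w.valuation L Z := by
        obtain ⟨N, hN, hN'⟩ := small_nat {w} (fun _ => Z) (fun _ _ => hZ)
        refine ⟨N, by exact_mod_cast hN.ne', ?_⟩
        have := hN' w (by simp)
        simpa using this.le
      obtain ⟨y, hy⟩ := dense_K q hμ Z e he.1
      refine ⟨y, ?_⟩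
      have := Valuation.map_sub_eq_of_lt_right (w.valuation L) (hy.trans_le he.2)
      rw [← this, ← Valuation.map_neg]; congr 1; ring
    have hy00 : y0 ≠ 0 := by
      rintro rfl
      rw [map_zero, map_zero, eq_comm, Valuation.zero_iff] at hy0; exact hZ hy0
    obtain ⟨e, he, he1, he2⟩ : ∃ e : K, e ≠ 0 ∧ w.valuation L (algebraMap K L e) ≤ w.valuation L (algebraMap K L y0) ∧
        w.valuation L (algebraMap K L e) ≤ w.valuation L (algebraMap K L (s / y0)) := by
      rcases le_total (w.valuation L (algebraMap K L y0)) (w.valuation L (algebraMap K L (s / y0))) with h | h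
      · exact ⟨y0, hy00, le_rfl, h⟩
      · exact ⟨s / y0, div_ne_zero hs hy00, h, le_rfl⟩
    obtain ⟨y, hy⟩ := dense_K q hμ Z e he
    refine ⟨y, ?_⟩
    have h1 : Z ^ 2 - (algebraMap K L y) ^ 2 = (Z - algebraMap K L y) * (Z + algebraMap K L y) := by ring
    have h2 : w.valuation L (Z + algebraMap K L y) ≤ w.valuation L (algebraMap K L y0) := by
      have e1 : Z + algebraMap K L y = 2 * Z - (Z - algebraMap K L y) := by ring
      rw [e1]
      refine (Valuation.map_sub _ _ _).trans (max_le ?_ (hy.le.trans he1))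
      rw [map_mul, hy0]
      exact mul_le_of_le_one_left' (v2_le w)
    have hpos : 0 < w.valuation L (algebraMap K L y0) := zero_lt_iff.2 (by
      rw [Valuation.ne_zero_iff]; simpa using hy00)
    rw [h1, map_mul]
    calc _ ≤ w.valuation L (Z - algebraMap K L y) * w.valuation L (algebraMap K L y0) := mul_le_mul' le_rfl h2
      _ < w.valuation L (algebraMap K L (s / y0)) * w.valuation L (algebraMap K L y0) := mul_lt_mul_of_pos_right (hy.trans_le he2) hpos
      _ = _ := by rw [← map_mul, ← map_mul]; congr 2; field_simp
  obtain ⟨x, hx⟩ := hb X ε hε0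
  obtain ⟨y, hy⟩ : ∃ y : K, w.valuation L (algebraMap K L a * (Y ^ 2 - (algebraMap K L y) ^ 2)) < w.valuation L (algebraMap K L ε) := by
    by_cases ha : a = 0
    · exact ⟨0, by simpa [ha, zero_lt_iff] using hε0⟩
    · obtain ⟨y, hy⟩ := hb Y (ε / a) (div_ne_zero hε0 ha)
      refine ⟨y, ?_⟩
      have hpos : 0 < w.valuation L (algebraMap K L a) := zero_lt_iff.2 (by
        rw [Valuation.ne_zero_iff]; simpa using ha)
      rw [map_mul]
      refine (mul_lt_mul_of_pos_left hy hpos).trans_le (le_of_eq ?_)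
      rw [← map_mul, ← map_mul]; congr 2; field_simp
  set m : K := x ^ 2 - a * y ^ 2 with hm
  have hmn : w.valuation L ((n : L) - algebraMap K L m) < w.valuation L (algebraMap K L ε) := by
    have : (n : L) - algebraMap K L m = (X ^ 2 - (algebraMap K L x) ^ 2) - (algebraMap K L a * (Y ^ 2 - (algebraMap K L y) ^ 2)) := by
      rw [hn, hm]; simp only [map_sub, map_mul, map_pow]; ring
    rw [this]
    exact Valuation.map_sub_lt _ hx hy
  have hcn : w.valuation L (algebraMap K L c - (n : L)) < w.valuation L (algebraMap K L ε) := by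
    have h1 : (algebraMap K L c : L) = n * u := by
      have := congrArg Units.val hc
      simpa using this.symm
    have : algebraMap K L c - (n : L) = n * (u - 1) := by rw [h1]; ring
    have hpos : 0 < w.valuation L (n : L) := zero_lt_iff.2 (by simp)
    rw [this, map_mul, hε, map_mul, map_mul, ← hcval, mul_comm (w.valuation L (algebraMap K L 4)), map_ofNat]
    exact mul_lt_mul_of_pos_left (mem_W.1 hu) hpos
  have hmc : (w.under (𝓞 K)).valuation K (m - c) < (w.under (𝓞 K)).valuation K 4 * (w.under (𝓞 K)).valuation K (c : K) := by
    rw [← map_mul, ← over_lt (w := w), map_sub]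
    have : algebraMap K L m - algebraMap K L c = - (((n : L) - algebraMap K L m) + (algebraMap K L c - n)) := by ring
    rw [this, Valuation.map_neg]
    exact Valuation.map_add_lt _ hmn hcn
  have hm0 : m ≠ 0 := by
    intro h
    rw [h, zero_sub, Valuation.map_neg] at hmc
    exact absurd hmc (not_lt.2 (mul_le_of_le_one_left' (v4_le _)))
  have hW := div_mem_W (x := Units.mk0 m hm0) (y := c) hmc
  have e : c = Units.mk0 m hm0 * (Units.mk0 m hm0 / c)⁻¹ := by simp
  rw [e]
  exact Subgroup.mul_mem_sup ⟨_, _, hm⟩ (inv_mem hW)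

lemma tc_of_neg {μ : Kˣ} (q : Quad K L μ) (h : ∀ φ : K →+* ℝ, φ μ < 0) : IsTotallyComplex L :=
  tc_of_no_real fun φ => by
    have h1 := h (φ.comp (algebraMap K L))
    have h2 := congrArg φ q.hr
    rw [map_pow] at h2
    simp only [RingHom.comp_apply] at h1
    rw [← h2] at h1
    nlinarith [sq_nonneg (φ q.r)]
end

lemma B2' (v₀ : Pl K) (a : Kˣ) {c c' : Kˣ} (hc : c ∉ Ng v₀ (a : K))
    (hc' : c' ∉ Ng v₀ (a : K)) : c * c' ∈ Ng v₀ (a : K) := by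
  by_cases hR : Nonempty (K →+* ℝ)
  swap
  · haveI : IsTotallyComplex K := tc_of_no_real fun φ => hR ⟨φ⟩
    exact B2_tc v₀ a hc hc'
  obtain ⟨φ⟩ := hR
  obtain ⟨N, hN, hN'⟩ := small_nat {v₀} (fun _ => (4 : K)) (by simp)
  have hN4 : v₀.valuation K (N : K) < v₀.valuation K 4 := hN' v₀ (by simp)
  have hN1 : 1 < N := by
    rcases Nat.lt_or_ge 1 N with h | h
    · exact h
    · have : N = 1 := by omega
      subst this
      rw [Nat.cast_one, map_one] at hN4
      exact absurd hN4 (not_lt.2 (v4_le v₀))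
  have hneg : ∀ ψ : K →+* ℝ, ψ (1 - (N : K)) < 0 := by
    intro ψ
    rw [map_sub, map_one, map_natCast]
    have : (1 : ℝ) < N := by exact_mod_cast hN1
    linarith
  have hne : (1 - (N : K)) ≠ 0 := by
    intro h; have := hneg φ; rw [h, map_zero] at this; exact lt_irrefl _ this
  set μ : Kˣ := Units.mk0 _ hne with hμ
  have hμns : μ ∉ GSq K := by
    rintro ⟨z, hz⟩
    have h1 := hneg φ
    have : (1 - (N : K)) = (z : K) ^ 2 := by
      have := congrArg Units.val hz
      simpa [hμ] using this.symm
    rw [this, map_pow] at h1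
    nlinarith [sq_nonneg (φ z)]
  obtain ⟨L, _, _, _, ⟨q⟩⟩ := exists_quad μ hμns
  haveI : IsTotallyComplex L := tc_of_neg q hneg
  obtain ⟨w, rfl⟩ := exists_above L v₀
  have hμS : μ ∈ Sq (w.under (𝓞 K)) := W_le_Sq _ (by
    rw [mem_W]
    have : (μ : K) - 1 = - (N : K) := by rw [hμ, Units.val_mk0]; ring
    rw [this, Valuation.map_neg]; exact hN4)
  apply Ng_down q hμS
  rw [map_mul]
  exact B2_tc w (inc K L a) (fun h => hc (Ng_down q hμS h)) (fun h => hc' (Ng_down q hμS h))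
end CQ

namespace CQ
open IsDedekindDomain NumberField WithZero
universe u
set_option linter.unusedSectionVars false
set_option linter.unusedSimpArgs false
set_option linter.unusedVariables false
set_option linter.style.haveILetI false
variable {K : Type u} [Field K] [NumberField K]

/-- a group is not the union of two proper subgroups -/
lemma not_union {A : Type*} [Group A] (H₁ H₂ : Subgroup A) :
    ∃ c : A, (H₁ ≠ ⊤ → c ∉ H₁) ∧ (H₂ ≠ ⊤ → c ∉ H₂) := by
  by_cases h1 : H₁ = ⊤
  · by_cases h2 : H₂ = ⊤
    · exact ⟨1, fun h => absurd h1 h, fun h => absurd h2 h⟩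
    · obtain ⟨c, hc⟩ : ∃ c, c ∉ H₂ := by
        by_contra! h'; exact h2 (by ext x; simp [h' x])
      exact ⟨c, fun h => absurd h1 h, fun _ => hc⟩
  obtain ⟨x, hx⟩ : ∃ c, c ∉ H₁ := by
    by_contra! h'; exact h1 (by ext x; simp [h' x])
  by_cases h2 : H₂ = ⊤
  · exact ⟨x, fun _ => hx, fun h => absurd h2 h⟩
  obtain ⟨y, hy⟩ : ∃ c, c ∉ H₂ := by
    by_contra! h'; exact h2 (by ext x; simp [h' x])
  by_cases hx2 : x ∈ H₂
  · by_cases hy1 : y ∈ H₁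
    · refine ⟨x * y, fun _ h => hx ?_, fun _ h => hy ?_⟩
      · exact (Subgroup.mul_mem_cancel_right _ hy1).1 h
      · exact (Subgroup.mul_mem_cancel_left _ hx2).1 h
    · exact ⟨y, fun _ => hy1, fun _ => hy⟩
  · exact ⟨x, fun _ => hx, fun _ => hx2⟩

lemma exists_neg (T : Finset (Pl K)) (x : Pl K → Kˣ) :
    ∃ d : Kˣ, (∀ v ∈ T, d / x v ∈ W v) ∧ d ∉ GSq K ∧ ∀ φ : K →+* ℝ, φ d < 0 := by
  classical
  obtain ⟨p, hp⟩ := exists_not_mem T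
  obtain ⟨π, hπ⟩ := exists_unif p
  set x' : Pl K → Kˣ := fun v => if v = p then π else x v with hx'
  have h40 : (4 : K) ≠ 0 := by norm_num
  have hy : ∀ v ∈ insert p T, (4 : K) * x' v ≠ 0 := fun v _ => mul_ne_zero h40 (x' v).ne_zero
  obtain ⟨c, hc⟩ := approx (insert p T) (fun v => x' v) (fun v => 4 * x' v) hy
  obtain ⟨N, hN, hN'⟩ := small_nat (insert p T) (fun v => 4 * x' v) hy
  obtain ⟨t, ht⟩ : ∃ t : ℕ, ∀ φ : K →+* ℝ, φ c < t := by
    haveI : Finite (K →+* ℝ) := by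
      refine Finite.of_injective (β := K →+* ℂ) (fun φ => Complex.ofRealHom.comp φ) ?_
      intro φ ψ h
      ext z
      have := congrArg (fun f : K →+* ℂ => f z) h
      simpa using this
    obtain ⟨M, hM⟩ := (Set.finite_range (fun φ : K →+* ℝ => φ c)).bddAbove
    obtain ⟨t, ht⟩ := exists_nat_gt M
    exact ⟨t, fun φ => (hM ⟨φ, rfl⟩).trans_lt ht⟩
  set d : K := c - N * t with hd
  have hdv : ∀ v ∈ insert p T, v.valuation K (d - x' v) < v.valuation K 4 * v.valuation K (x' v : K) := by
    intro v hv
    have e : d - x' v = (c - x' v) - N * t := by rw [hd]; ring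
    rw [e, ← map_mul]
    refine Valuation.map_sub_lt _ (hc v hv) ?_
    rw [map_mul]
    refine (mul_le_of_le_one_right' ?_).trans_lt (hN' v hv)
    have := HeightOneSpectrum.valuation_le_one (K := K) v (t : 𝓞 K)
    simpa using this
  have hd0 : d ≠ 0 := by
    intro h
    have := hdv p (by simp)
    rw [h, zero_sub, Valuation.map_neg] at this
    exact absurd this (not_lt.2 (mul_le_of_le_one_left' (v4_le _)))
  have hW : ∀ v ∈ insert p T, Units.mk0 d hd0 / x' v ∈ W v := fun v hv => div_mem_W (hdv v hv)
  refine ⟨Units.mk0 d hd0, fun v hv => ?_, ?_, fun φ => ?_⟩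
  · have := hW v (by simp [hv])
    have hvp : v ≠ p := by rintro rfl; exact hp hv
    simpa only [hx', if_neg hvp] using this
  · refine val_sq_ne (v := p) ?_
    have := W_val (hW p (by simp))
    have hxp : x' p = π := by simp [hx']
    rw [hxp, Units.val_div_eq_div_val, map_div₀, hπ] at this
    rw [div_eq_one_iff_eq (by simp)] at this
    exact this
  · have h1 := ht φ
    rw [Units.val_mk0, hd, map_sub, map_mul, map_natCast, map_natCast]
    have h2 : (1 : ℝ) ≤ N := by exact_mod_cast hN
    have h3 : (0 : ℝ) ≤ t := by positivity
    nlinarith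

/-- if the local norm condition holds everywhere then the conic has a point -/
lemma final_tc [IsTotallyComplex K] (a b : Kˣ) (h : ∀ w : Pl K, b ∈ Ng w (a : K)) :
    ∃ x y z : K, (x, y, z) ≠ (0, 0, 0) ∧ x ^ 2 - a * y ^ 2 - b * z ^ 2 = 0 := by
  classical
  by_cases ha : a ∈ GSq K
  · obtain ⟨r, hr⟩ := ha
    refine ⟨r, 1, 0, by simp, ?_⟩
    rw [← hr]; simp
  suffices hb : b ∈ Nm (a : K) by
    obtain ⟨x, y, hxy⟩ := hb
    exact ⟨x, y, 1, by simp, by rw [hxy]; ring⟩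
  set D := (finite_val (K := K) (Units.mk0 2 two_ne_zero)).toFinset with hD
  have hn : ∀ w : Pl K, ∃ x y : K, ∃ n : Kˣ, (n : K) = x ^ 2 - a * y ^ 2 ∧ b / n ∈ W w := by
    intro w
    obtain ⟨n, ⟨x, y, hn⟩, u, hu, hnu⟩ := mem_Ng.1 (h w)
    exact ⟨x, y, n, hn, by rw [← hnu]; simpa using hu⟩
  obtain ⟨n, hnN, hnW⟩ : ∃ n ∈ Nm (a : K), ∀ w ∈ D, b / n ∈ W w := by
    choose x y n hn hW using hn
    rcases D.eq_empty_or_nonempty with hDe | ⟨w₀, hw₀⟩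
    · rw [hDe]; exact ⟨1, one_mem _, by simp⟩
    set ε : Pl K → K := fun w => 4 * n w with hε
    have hε0 : ∀ w, ε w ≠ 0 := fun w => mul_ne_zero (by norm_num) (n w).ne_zero
    have key : ∀ (m : Kˣ) (X : Pl K → K), ∃ c : K, ∀ w ∈ D, w.valuation K (m * (c ^ 2 - X w ^ 2)) < w.valuation K (ε w) := by
      intro m X
      have he : ∀ w : Pl K, ∃ e : K, e ≠ 0 ∧ w.valuation K (m * (e * e)) ≤ w.valuation K (ε w) ∧
          w.valuation K (m * (e * X w)) ≤ w.valuation K (ε w) := by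
        intro w
        have hm0 := m.ne_zero
        by_cases hX : X w = 0
        · obtain ⟨N, hN, hN'⟩ := small_nat {w} (fun w => ε w / m) (fun w _ => div_ne_zero (hε0 w) hm0)
          have h1 := hN' w (by simp)
          refine ⟨N, by exact_mod_cast hN.ne', ?_, by simp [hX]⟩
          have h2 : w.valuation K (N : K) ≤ 1 := by
            have := HeightOneSpectrum.valuation_le_one (K := K) w (N : 𝓞 K)
            simpa using this
          rw [map_mul, map_mul]
          calc _ ≤ w.valuation K m * (w.valuation K (N : K) * 1) := by gcongr
            _ ≤ w.valuation K m * w.valuation K (ε w / m) := by rw [mul_one]; gcongr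
            _ = _ := by rw [← map_mul]; congr 1; field_simp
        · obtain ⟨N, hN, hN'⟩ := small_nat {w} (fun w => ε w / m) (fun w _ => div_ne_zero (hε0 w) hm0)
          obtain ⟨M, hM, hM'⟩ := small_nat {w} (fun w => ε w / m / X w) (fun _ hw => by
            rw [Finset.mem_singleton] at hw; subst hw; exact div_ne_zero (div_ne_zero (hε0 _) hm0) hX)
          have h1 := hN' w (by simp)
          have h1' := hM' w (by simp)
          have hNi : ∀ N : ℕ, w.valuation K (N : K) ≤ 1 := fun N => by
            have := HeightOneSpectrum.valuation_le_one (K := K) w (N : 𝓞 K)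
            simpa using this
          refine ⟨N * M, mul_ne_zero (by exact_mod_cast hN.ne') (by exact_mod_cast hM.ne'), ?_, ?_⟩
          · simp only [map_mul]
            calc _ ≤ w.valuation K m * ((w.valuation K (N : K) * 1) * (1 * 1)) := by
                  gcongr <;> exact hNi _
              _ ≤ w.valuation K m * w.valuation K (ε w / m) := by simp only [mul_one]; gcongr
              _ = _ := by rw [← map_mul]; congr 1; field_simp
          · simp only [map_mul]
            calc _ ≤ w.valuation K m * ((1 * w.valuation K (M : K)) * w.valuation K (X w)) := by
                  gcongr; exact hNi _
              _ ≤ w.valuation K m * (w.valuation K (ε w / m / X w) * w.valuation K (X w)) := by rw [one_mul]; gcongr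
              _ = _ := by rw [← map_mul, ← map_mul]; congr 1; field_simp
      choose e he0 he1 he2 using he
      obtain ⟨c, hc⟩ := approx D X e (fun w _ => he0 w)
      refine ⟨c, fun w hw => ?_⟩
      have h1 := hc w hw
      have hm : 0 < w.valuation K (m : K) := zero_lt_iff.2 (by simp)
      have e1 : (m : K) * (c ^ 2 - X w ^ 2) = m * ((c - X w) * (c - X w)) + 2 * (m * ((c - X w) * X w)) := by ring
      have hew : 0 < w.valuation K (ε w) := zero_lt_iff.2 (by rw [Valuation.ne_zero_iff]; exact hε0 w)
      rw [e1]
      refine Valuation.map_add_lt _ ?_ ?_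
      · refine lt_of_lt_of_le ?_ (he1 w)
        rw [map_mul, map_mul, map_mul, map_mul]
        exact mul_lt_mul_of_pos_left (mul_lt_mul'' h1 h1 zero_le zero_le) hm
      · rw [map_mul]
        refine (mul_le_of_le_one_left' (v2_le w)).trans_lt ?_
        by_cases hX : X w = 0
        · simpa [hX] using hew
        · refine lt_of_lt_of_le ?_ (he2 w)
          rw [map_mul, map_mul, map_mul, map_mul]
          exact mul_lt_mul_of_pos_left (mul_lt_mul_of_pos_right h1 (zero_lt_iff.2 (by simpa using hX))) hm
    obtain ⟨x', hx'⟩ := key 1 x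
    obtain ⟨y', hy'⟩ := key a y
    set m : K := x' ^ 2 - a * y' ^ 2 with hm
    have hmv : ∀ w ∈ D, w.valuation K (m - n w) < w.valuation K 4 * w.valuation K (n w : K) := by
      intro w hw
      have e1 : m - n w = ((1 : Kˣ) : K) * (x' ^ 2 - x w ^ 2) - a * (y' ^ 2 - y w ^ 2) := by
        rw [hm, hn w, Units.val_one]; ring
      rw [e1, ← map_mul]
      exact Valuation.map_sub_lt _ (hx' w hw) (hy' w hw)
    have hm0 : m ≠ 0 := by
      intro h
      have := hmv w₀ hw₀
      rw [h, zero_sub, Valuation.map_neg] at this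
      exact absurd this (not_lt.2 (mul_le_of_le_one_left' (v4_le _)))
    refine ⟨Units.mk0 m hm0, ⟨_, _, hm⟩, fun w hw => ?_⟩
    have := div_mem_W (x := Units.mk0 m hm0) (hmv w hw)
    have e2 : b / Units.mk0 m hm0 = (b / n w) / (Units.mk0 m hm0 / n w) := by
      rw [div_div_div_cancel_right]
    rw [e2]
    exact div_mem (hW w) this
  set b' := b / n with hb'
  have hbb : b = b' * n := by simp [hb']
  suffices hb1 : b' ∈ Nm (a : K) by rw [hbb]; exact mul_mem hb1 hnN
  by_cases hsq : b' ∈ GSq K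
  · exact GSq_le_Nm _ hsq
  have hb'N : ∀ w : Pl K, b' ∈ Ng w (a : K) := fun w => div_mem (h w) (Nm_le_Ng w _ hnN)
  obtain ⟨S, hS1, hS⟩ := exists_good ((finite_val a).toFinset ∪ (finite_val b').toFinset)
  have haU : a ∈ U S := by
    intro v hv; by_contra h; exact hv (hS1 (by simp [h]))
  have hbU : b' ∈ U S := by
    intro v hv; by_contra h; exact hv (hS1 (by simp [h]))
  have hodd : ∀ v ∈ S, b' ∉ Sq v → v.valuation K 2 = 1 := by
    intro v _ hv
    by_contra h2
    exact hv (W_le_Sq v (hnW v (by rw [hD, Set.Finite.mem_toFinset]; exact h2)))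
  obtain ⟨x, y, hxy⟩ := lemB1 hS hbU hsq hodd haU (fun v hv hvb => Ng_symm (hodd v hv hvb) hvb (hb'N v))
  have hy : y ≠ 0 := by
    rintro rfl
    have hx0 : x ≠ 0 := by rintro rfl; exact a.ne_zero (by rw [hxy]; simp)
    exact ha ⟨Units.mk0 x hx0, by ext; simp [hxy]⟩
  refine ⟨x / y, 1 / y, ?_⟩
  field_simp
  linear_combination hxy

lemma final_k (a₁ b₁ a₂ b₂ : Kˣ) : ∃ (L : Type u) (_ : Field L) (_ : Algebra K L), Module.finrank K L = 2 ∧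
    (∃ x y z : L, (x, y, z) ≠ (0, 0, 0) ∧ x ^ 2 - algebraMap K L a₁ * y ^ 2 - algebraMap K L b₁ * z ^ 2 = 0) ∧
    (∃ x y z : L, (x, y, z) ≠ (0, 0, 0) ∧ x ^ 2 - algebraMap K L a₂ * y ^ 2 - algebraMap K L b₂ * z ^ 2 = 0) := by
  classical
  set B := (finite_val (K := K) (Units.mk0 2 two_ne_zero)).toFinset ∪ (finite_val a₁).toFinset ∪
    (finite_val b₁).toFinset ∪ (finite_val a₂).toFinset ∪ (finite_val b₂).toFinset with hB
  choose c hc1 hc2 using fun v : Pl K => not_union (Ng v (a₁ : K)) (Ng v (a₂ : K))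
  obtain ⟨d, hd1, hd2, hd3⟩ := exists_neg B c
  obtain ⟨L, _, _, _, ⟨q⟩⟩ := exists_quad d hd2
  haveI : IsTotallyComplex L := tc_of_neg q hd3
  have key : ∀ a b : Kˣ, (∀ v ∉ B, v.valuation K (a : K) = 1 ∧ v.valuation K (b : K) = 1) →
      (∀ v, Ng v (a : K) ≠ ⊤ → c v ∉ Ng v (a : K)) → ∀ w : Pl L, inc K L b ∈ Ng w (inc K L a : L) := by
    intro a b hab hca w
    by_cases hv : w.under (𝓞 K) ∈ B
    · by_cases hb : b ∈ Ng (w.under (𝓞 K)) (a : K)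
      · exact inc_Ng hb
      · have hc := hca (w.under (𝓞 K)) (fun h => hb (by rw [h]; trivial))
        have h1 := inc_Ng (L := L) (w := w) (B2' _ a hb hc)
        have h2 : inc K L (c (w.under (𝓞 K))) ∈ Sq w := q.inc_mul (by
          have e : c (w.under (𝓞 K)) * d = c (w.under (𝓞 K)) ^ 2 * (d / c (w.under (𝓞 K))) := by
            rw [pow_two, mul_assoc, mul_div_cancel]
          rw [e]
          exact mul_mem (sq_mem_Sq _ _) (W_le_Sq _ (hd1 _ hv)))
        rw [map_mul] at h1
        exact (Subgroup.mul_mem_cancel_right _ (Sq_le_Ng w _ h2)).1 h1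
    · obtain ⟨h1, h2⟩ := hab _ hv
      refine unit_mem_Ng ?_ (over_one.2 h1) (over_one.2 h2)
      have h3 : (w.under (𝓞 K)).valuation K (2 : K) = 1 := by
        by_contra h
        exact hv (by simp [hB, h])
      have := over_one (w := w) (x := (2 : K)).2 h3
      rwa [map_ofNat] at this
  refine ⟨L, inferInstance, inferInstance, q.fr, ?_, ?_⟩
  · exact final_tc (inc K L a₁) (inc K L b₁) (key a₁ b₁ (fun v hv => by
      simp [hB] at hv; tauto) hc1)
  · exact final_tc (inc K L a₂) (inc K L b₂) (key a₂ b₂ (fun v hv => by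
      simp [hB] at hv; tauto) hc2)
end CQ

/-- Over a number field `k`, any two smooth conics `x² − a₁y² − b₁z² = 0` and
`x² − a₂y² − b₂z² = 0` acquire nontrivial points over a common quadratic
extension `k'` of `k`. -/
theorem conics_common_quadratic_splitting_field
    (k : Type*) [Field k] [NumberField k]
    (a₁ b₁ a₂ b₂ : k) (ha₁ : a₁ ≠ 0) (hb₁ : b₁ ≠ 0) (ha₂ : a₂ ≠ 0) (hb₂ : b₂ ≠ 0) :
    ∃ (k' : Type) (_ : Field k') (_ : Algebra k k'),
      Module.finrank k k' = 2 ∧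
      (∃ x y z : k', (x, y, z) ≠ (0, 0, 0) ∧
        x ^ 2 - algebraMap k k' a₁ * y ^ 2 - algebraMap k k' b₁ * z ^ 2 = 0) ∧
      (∃ x y z : k', (x, y, z) ≠ (0, 0, 0) ∧
        x ^ 2 - algebraMap k k' a₂ * y ^ 2 - algebraMap k k' b₂ * z ^ 2 = 0) := by
  obtain ⟨L, _, _, hfr, ⟨x, y, z, hne, h⟩, ⟨x', y', z', hne', h'⟩⟩ :=
    CQ.final_k (Units.mk0 a₁ ha₁) (Units.mk0 b₁ hb₁) (Units.mk0 a₂ ha₂) (Units.mk0 b₂ hb₂)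
  have hkc : Countable k := (Module.finBasis ℚ k).equivFun.injective.countable
  haveI : FiniteDimensional k L := FiniteDimensional.of_finrank_pos (by rw [hfr]; norm_num)
  have hLc : Countable L := (Module.finBasis k L).equivFun.injective.countable
  let e : Shrink.{0} L ≃ₐ[k] L := (equivShrink.{0} L).symm.algEquiv k
  have key : ∀ (a b : k) (x y z : L), (x, y, z) ≠ (0, 0, 0) →
      x ^ 2 - algebraMap k L a * y ^ 2 - algebraMap k L b * z ^ 2 = 0 →
      ∃ x y z : Shrink.{0} L, (x, y, z) ≠ (0, 0, 0) ∧
        x ^ 2 - algebraMap k (Shrink.{0} L) a * y ^ 2 - algebraMap k (Shrink.{0} L) b * z ^ 2 = 0 := by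
    intro a b x y z hne h
    refine ⟨e.symm x, e.symm y, e.symm z, ?_, ?_⟩
    · intro h0
      apply hne
      simpa using h0
    · have := congrArg e.symm h
      simpa using this
  exact ⟨Shrink.{0} L, inferInstance, inferInstance, by rw [e.toLinearEquiv.finrank_eq, hfr],
    key a₁ b₁ x y z hne h, key a₂ b₂ x' y' z' hne' h'⟩
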